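/- arXiv:2107.12274 — 17 statements merged into one kernel-verified Lean document; each statement's English description precedes it below -/
import Mathlib

section
/- Let p₁,p₂ ∈ ℕ with 1 ≤ p₁ ≤ p₂ and let ε ≥ 0. Then ε-wargmin_x(VP_{p₁}) ⊆ ε-wargmin_x(VP_{p₂}): every x̄ that is the x-component of an ε-weakly minimal solution of (VP_{p₁}) is also the x-component of an ε-weakly minimal solution of (VP_{p₂}). -/
open Set Pointwise

noncomputable section

/-- The set `A - v` (translate of `A` by `-v`). -/
def shiftSet {m : ℕ} (A : Set (Fin m → ℝ)) (v : Fin m → ℝ) : Set (Fin m → ℝ) :=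
  (fun y => y - v) '' A

/-- `ε`-weakly minimal solutions of the set optimization problem (SP). -/
def SPwmin {n m : ℕ} (Ω : Set (Fin n → ℝ)) (F : (Fin n → ℝ) → Set (Fin m → ℝ))
    (K : Set (Fin m → ℝ)) (e : Fin m → ℝ) (ε : ℝ) : Set (Fin n → ℝ) :=
  {xb | xb ∈ Ω ∧ ¬ ∃ x ∈ Ω, shiftSet (F xb) (ε • e) ⊆ F x + interior K}

/-- Type-one `ε`-minimal solutions of (SP). -/
def SPargmin1 {n m : ℕ} (Ω : Set (Fin n → ℝ)) (F : (Fin n → ℝ) → Set (Fin m → ℝ))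
    (K : Set (Fin m → ℝ)) (e : Fin m → ℝ) (ε : ℝ) : Set (Fin n → ℝ) :=
  {xb | xb ∈ Ω ∧ ∀ x ∈ Ω,
    shiftSet (F xb) (ε • e) ⊆ F x + K → F x ⊆ shiftSet (F xb) (ε • e) + K}

/-- Type-two `ε`-minimal solutions of (SP). -/
def SPargmin2 {n m : ℕ} (Ω : Set (Fin n → ℝ)) (F : (Fin n → ℝ) → Set (Fin m → ℝ))
    (K : Set (Fin m → ℝ)) (e : Fin m → ℝ) (ε : ℝ) : Set (Fin n → ℝ) :=
  {xb | xb ∈ Ω ∧ ¬ ∃ x ∈ Ω, shiftSet (F xb) (ε • e) ⊆ F x + (K \ {0})}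

/-- Feasibility for the multiobjective problem (VP_p). -/
def VPfeas {n m : ℕ} (Ω : Set (Fin n → ℝ)) (F : (Fin n → ℝ) → Set (Fin m → ℝ))
    (p : ℕ) (x : Fin n → ℝ) (y : Fin p → Fin m → ℝ) : Prop :=
  x ∈ Ω ∧ ∀ i, y i ∈ F x

/-- `(xb, yb¹, …, ybᵖ)` is an `ε`-weakly minimal solution of (VP_p). -/
def VPwSol {n m : ℕ} (Ω : Set (Fin n → ℝ)) (F : (Fin n → ℝ) → Set (Fin m → ℝ))
    (K : Set (Fin m → ℝ)) (e : Fin m → ℝ) (p : ℕ) (ε : ℝ)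
    (xb : Fin n → ℝ) (yb : Fin p → Fin m → ℝ) : Prop :=
  VPfeas Ω F p xb yb ∧
    ¬ ∃ x y, VPfeas Ω F p x y ∧ ∀ i, (yb i - ε • e) - y i ∈ interior K

/-- Projection onto the `x`-component of the `ε`-weakly minimal solutions of (VP_p). -/
def VPwX {n m : ℕ} (Ω : Set (Fin n → ℝ)) (F : (Fin n → ℝ) → Set (Fin m → ℝ))
    (K : Set (Fin m → ℝ)) (e : Fin m → ℝ) (p : ℕ) (ε : ℝ) : Set (Fin n → ℝ) :=
  {xb | ∃ yb, VPwSol Ω F K e p ε xb yb}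

/-- `(xb, yb¹, …, ybᵖ)` is an `ε`-minimal solution of (VP_p). -/
def VPmSol {n m : ℕ} (Ω : Set (Fin n → ℝ)) (F : (Fin n → ℝ) → Set (Fin m → ℝ))
    (K : Set (Fin m → ℝ)) (e : Fin m → ℝ) (p : ℕ) (ε : ℝ)
    (xb : Fin n → ℝ) (yb : Fin p → Fin m → ℝ) : Prop :=
  VPfeas Ω F p xb yb ∧
    ¬ ∃ x y, VPfeas Ω F p x y ∧ (∀ i, (yb i - ε • e) - y i ∈ K) ∧
      y ≠ fun i => yb i - ε • e

/-- Projection onto the `x`-component of the `ε`-minimal solutions of (VP_p). -/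
def VPmX {n m : ℕ} (Ω : Set (Fin n → ℝ)) (F : (Fin n → ℝ) → Set (Fin m → ℝ))
    (K : Set (Fin m → ℝ)) (e : Fin m → ℝ) (p : ℕ) (ε : ℝ) : Set (Fin n → ℝ) :=
  {xb | ∃ yb, VPmSol Ω F K e p ε xb yb}

/-- Minimal elements of `A` with respect to the cone `K`. -/
def MinSet {m : ℕ} (A K : Set (Fin m → ℝ)) : Set (Fin m → ℝ) :=
  {y | y ∈ A ∧ ({y} - K) ∩ A = {y}}

/-- Weakly minimal elements of `A` with respect to the cone `K`. -/
def WMinSet {m : ℕ} (A K : Set (Fin m → ℝ)) : Set (Fin m → ℝ) :=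
  {y | y ∈ A ∧ ({y} - interior K) ∩ A = ∅}

/-- Euclidean dot product. -/
def dot {k : ℕ} (a b : Fin k → ℝ) : ℝ := ∑ i, a i * b i

/-- Graph of a set-valued mapping. -/
def gph {n m : ℕ} (F : (Fin n → ℝ) → Set (Fin m → ℝ)) :
    Set ((Fin n → ℝ) × (Fin m → ℝ)) :=
  {q | q.2 ∈ F q.1}

/-- Normal cone (of convex analysis) to a subset of the product space. -/
def normalConeProd {n m : ℕ} (C : Set ((Fin n → ℝ) × (Fin m → ℝ)))
    (qb : (Fin n → ℝ) × (Fin m → ℝ)) : Set ((Fin n → ℝ) × (Fin m → ℝ)) :=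
  {w | ∀ q ∈ C, dot w.1 (q.1 - qb.1) + dot w.2 (q.2 - qb.2) ≤ 0}

/-- Dual cone. -/
def dualCone {m : ℕ} (K : Set (Fin m → ℝ)) : Set (Fin m → ℝ) :=
  {v | ∀ y ∈ K, 0 ≤ dot v y}

/-- Coderivative of a set-valued mapping with convex graph. -/
def coderiv {n m : ℕ} (F : (Fin n → ℝ) → Set (Fin m → ℝ))
    (xb : Fin n → ℝ) (yb : Fin m → ℝ) (v : Fin m → ℝ) : Set (Fin n → ℝ) :=
  {u | (u, -v) ∈ normalConeProd (gph F) (xb, yb)}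

theorem stmt2 (n m : ℕ)
    (Ω : Set (Fin n → ℝ)) (F : (Fin n → ℝ) → Set (Fin m → ℝ))
    (K : Set (Fin m → ℝ)) (e : Fin m → ℝ)
    (hΩne : Ω.Nonempty) (hΩcl : IsClosed Ω)
    (hdom : ∀ x ∈ Ω, (F x).Nonempty) (hFcpt : ∀ x ∈ Ω, IsCompact (F x))
    (hKcl : IsClosed K) (hKconv : Convex ℝ K)
    (hKcone : ∀ t : ℝ, 0 ≤ t → ∀ y ∈ K, t • y ∈ K)
    (hKpointed : K ∩ (-K) = {0})
    (he : e ∈ interior K)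
    (p₁ p₂ : ℕ) (hp₁ : 1 ≤ p₁) (hp : p₁ ≤ p₂) (ε : ℝ) (hε : 0 ≤ ε) :
    VPwX Ω F K e p₁ ε ⊆ VPwX Ω F K e p₂ ε := by
  rintro xb ⟨yb, ⟨hx, hy⟩, hmin⟩
  let g : Fin p₂ → Fin p₁ := fun i => if h : i.1 < p₁ then ⟨i.1, h⟩ else ⟨0, hp₁⟩
  have hg : ∀ i : Fin p₁, g (Fin.castLE hp i) = i := by
    intro i
    simp [g]
  refine ⟨fun i => yb (g i), ⟨hx, fun i => hy _⟩, ?_⟩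
  rintro ⟨x, y, ⟨hx', hy'⟩, hlt⟩
  refine hmin ⟨x, fun i => y (Fin.castLE hp i), ⟨hx', fun i => hy' _⟩, fun i => ?_⟩
  have h := hlt (Fin.castLE hp i)
  simp only [hg] at h
  exact h
end
end

section
/- Let p₁,p₂ ∈ ℕ with 1 ≤ p₁ ≤ p₂ and let ε ≥ 0. Then ε-argmin_x(VP_{p₁}) ⊆ ε-argmin_x(VP_{p₂}): every x̄ that is the x-component of an ε-minimal solution of (VP_{p₁}) is also the x-component of an ε-minimal solution of (VP_{p₂}). -/
open Set Pointwise

noncomputable section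

theorem stmt3 (n m : ℕ)
    (Ω : Set (Fin n → ℝ)) (F : (Fin n → ℝ) → Set (Fin m → ℝ))
    (K : Set (Fin m → ℝ)) (e : Fin m → ℝ)
    (hΩne : Ω.Nonempty) (hΩcl : IsClosed Ω)
    (hdom : ∀ x ∈ Ω, (F x).Nonempty) (hFcpt : ∀ x ∈ Ω, IsCompact (F x))
    (hKcl : IsClosed K) (hKconv : Convex ℝ K)
    (hKcone : ∀ t : ℝ, 0 ≤ t → ∀ y ∈ K, t • y ∈ K)
    (hKpointed : K ∩ (-K) = {0})
    (he : e ∈ interior K)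
    (p₁ p₂ : ℕ) (hp₁ : 1 ≤ p₁) (hp : p₁ ≤ p₂) (ε : ℝ) (hε : 0 ≤ ε) :
    VPmX Ω F K e p₁ ε ⊆ VPmX Ω F K e p₂ ε := by
  rintro xb ⟨yb, ⟨hx, hy⟩, hmin⟩
  -- pad the tuple by repeating its first component
  let f : Fin p₂ → Fin p₁ := fun j => if h : j.1 < p₁ then ⟨j.1, h⟩ else ⟨0, hp₁⟩
  have hf : ∀ i : Fin p₁, f (Fin.castLE hp i) = i := by
    intro i
    simp [f]
  refine ⟨fun j => yb (f j), ⟨hx, fun j => hy (f j)⟩, ?_⟩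
  rintro ⟨x, y, ⟨hxΩ, hyF⟩, hdomin, hne⟩
  obtain ⟨j, hj⟩ := Function.ne_iff.mp hne
  -- a section of f passing through j
  let g : Fin p₁ → Fin p₂ := fun i => if i = f j then j else Fin.castLE hp i
  have hg : ∀ i, f (g i) = i := by
    intro i
    by_cases h : i = f j
    · simp [g, h]
    · simp [g, h, hf]
  have hgj : g (f j) = j := by simp [g]
  refine hmin ⟨x, fun i => y (g i), ⟨hxΩ, fun i => hyF (g i)⟩, fun i => ?_, fun heq => hj ?_⟩
  · have := hdomin (g i)
    simpa only [hg] using this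
  · have := congrFun heq (f j)
    simpa only [hgj] using this
end
end

section
/- Let p ∈ ℕ (p ≥ 1) and ε ≥ 0. Then ε-wargmin_x(VP_p) ⊆ ε-wargmin(SP): if (x̄,ȳ¹,…,ȳᵖ) is an ε-weakly minimal solution of (VP_p), then x̄ is an ε-weakly minimal solution of (SP). -/
open Set Pointwise

noncomputable section

theorem stmt4 (n m : ℕ)
    (Ω : Set (Fin n → ℝ)) (F : (Fin n → ℝ) → Set (Fin m → ℝ))
    (K : Set (Fin m → ℝ)) (e : Fin m → ℝ)
    (hΩne : Ω.Nonempty) (hΩcl : IsClosed Ω)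
    (hdom : ∀ x ∈ Ω, (F x).Nonempty) (hFcpt : ∀ x ∈ Ω, IsCompact (F x))
    (hKcl : IsClosed K) (hKconv : Convex ℝ K)
    (hKcone : ∀ t : ℝ, 0 ≤ t → ∀ y ∈ K, t • y ∈ K)
    (hKpointed : K ∩ (-K) = {0})
    (he : e ∈ interior K)
    (p : ℕ) (hp : 1 ≤ p) (ε : ℝ) (hε : 0 ≤ ε) :
    VPwX Ω F K e p ε ⊆ SPwmin Ω F K e ε := by
  rintro xb ⟨yb, ⟨hx, hy⟩, hno⟩
  refine ⟨hx, ?_⟩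
  rintro ⟨x, hxΩ, hsub⟩
  have h : ∀ i, ∃ z ∈ F x, (yb i - ε • e) - z ∈ interior K := by
    intro i
    have hmem : yb i - ε • e ∈ F x + interior K := hsub ⟨yb i, hy i, rfl⟩
    obtain ⟨z, hz, k, hk, hzk⟩ := Set.mem_add.1 hmem
    refine ⟨z, hz, ?_⟩
    rw [← hzk, add_sub_cancel_left]
    exact hk
  choose y hyF hyK using h
  exact hno ⟨x, y, ⟨hxΩ, hyF⟩, hyK⟩
end
end

section
/- Let p ∈ ℕ (p ≥ 1) and ε ≥ 0. Then ε-argmin_x(VP_p) ⊆ ε-argmin₂(SP): if (x̄,ȳ¹,…,ȳᵖ) is an ε-minimal solution of (VP_p), then x̄ is a type-two ε-minimal solution of (SP). -/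
open Set Pointwise

noncomputable section

theorem stmt5 (n m : ℕ)
    (Ω : Set (Fin n → ℝ)) (F : (Fin n → ℝ) → Set (Fin m → ℝ))
    (K : Set (Fin m → ℝ)) (e : Fin m → ℝ)
    (hΩne : Ω.Nonempty) (hΩcl : IsClosed Ω)
    (hdom : ∀ x ∈ Ω, (F x).Nonempty) (hFcpt : ∀ x ∈ Ω, IsCompact (F x))
    (hKcl : IsClosed K) (hKconv : Convex ℝ K)
    (hKcone : ∀ t : ℝ, 0 ≤ t → ∀ y ∈ K, t • y ∈ K)
    (hKpointed : K ∩ (-K) = {0})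
    (he : e ∈ interior K)
    (p : ℕ) (hp : 1 ≤ p) (ε : ℝ) (hε : 0 ≤ ε) :
    VPmX Ω F K e p ε ⊆ SPargmin2 Ω F K e ε := by
  rintro xb ⟨yb, ⟨hxb, hyb⟩, hmin⟩
  refine ⟨hxb, ?_⟩
  rintro ⟨x, hx, hsub⟩
  have key : ∀ i, ∃ a ∈ F x, ∃ k ∈ K \ {0}, a + k = yb i - ε • e := fun i =>
    Set.mem_add.1 (hsub ⟨yb i, hyb i, rfl⟩)
  choose y hy k hk hyk using key
  refine hmin ⟨x, y, ⟨hx, hy⟩, fun i => ?_, fun h => ?_⟩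
  · rw [← hyk i, add_sub_cancel_left]
    exact (hk i).1
  · have h0 := congrFun h ⟨0, hp⟩
    have h1 := hyk ⟨0, hp⟩
    rw [← h0] at h1
    exact (hk ⟨0, hp⟩).2 (by simpa using h1)
end
end

section
/- Let p ∈ ℕ (p ≥ 1). (a) For every x̄ ∈ wargmin_x(VP_p) there exist ȳ¹,…,ȳᵖ ∈ Min(F(x̄),K) such that (x̄,ȳ¹,…,ȳᵖ) is a weakly minimal solution of (VP_p). (b) Conversely, if (x̄,ȳ¹,…,ȳᵖ) is a weakly minimal solution of (VP_p), then ȳⁱ ∈ WMin(F(x̄),K) for at least one index i ∈ {1,…,p}. -/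
open Set Pointwise

noncomputable section

theorem exists_minSet_below {m : ℕ} (A K : Set (Fin m → ℝ)) (hA : IsCompact A)
    (hKcl : IsClosed K) (hadd : ∀ a ∈ K, ∀ b ∈ K, a + b ∈ K)
    (hKpointed : K ∩ (-K) = {0}) (y : Fin m → ℝ) (hy : y ∈ A) :
    ∃ z ∈ MinSet A K, y - z ∈ K := by
  have h0 : (0 : Fin m → ℝ) ∈ K := by
    have : (0 : Fin m → ℝ) ∈ K ∩ (-K) := by rw [hKpointed]; rfl
    exact this.1
  have htr : ∀ a b c : Fin m → ℝ, a - b ∈ K → b - c ∈ K → a - c ∈ K := by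
    intro a b c h1 h2
    have := hadd _ h1 _ h2
    simpa using this
  let S : Set (Fin m → ℝ) := {z | z ∈ A ∧ y - z ∈ K}
  obtain ⟨z, hz⟩ := exists_maximal_of_chains_bounded (α := S)
    (r := fun a b => a.1 - b.1 ∈ K) (by
      intro c hc
      rcases c.eq_empty_or_nonempty with rfl | ⟨a0, ha0⟩
      · exact ⟨⟨y, hy, by simpa using h0⟩, by simp⟩
      · have : Nonempty c := ⟨⟨a0, ha0⟩⟩
        let T : c → Set (Fin m → ℝ) := fun a => A ∩ {w | a.1.1 - w ∈ K}
        have hTcl : ∀ a : c, IsClosed {w : Fin m → ℝ | a.1.1 - w ∈ K} := by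
          intro a
          exact hKcl.preimage (by fun_prop : Continuous fun w : Fin m → ℝ => a.1.1 - w)
        have hcp : ∀ a : c, IsCompact (T a) := fun a => hA.inter_right (hTcl a)
        have hne := IsCompact.nonempty_iInter_of_directed_nonempty_isCompact_isClosed T (by
            intro a b
            rcases eq_or_ne a.1 b.1 with hab | hab
            · refine ⟨a, subset_rfl, ?_⟩
              rw [Subtype.ext hab]
            · rcases hc a.2 b.2 hab with h | h
              · exact ⟨b, fun w hw => ⟨hw.1, htr _ _ _ h hw.2⟩, subset_rfl⟩
              · exact ⟨a, subset_rfl, fun w hw => ⟨hw.1, htr _ _ _ h hw.2⟩⟩)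
          (fun a => ⟨a.1.1, a.1.2.1, by simpa using h0⟩) hcp (fun a => (hcp a).isClosed)
        obtain ⟨w, hw⟩ := hne
        rw [mem_iInter] at hw
        exact ⟨⟨w, (hw ⟨a0, ha0⟩).1, htr _ _ _ a0.2.2 (hw ⟨a0, ha0⟩).2⟩,
          fun a ha => (hw ⟨a, ha⟩).2⟩)
    (fun {a b c} h1 h2 => htr _ _ _ h1 h2)
  refine ⟨z.1, ⟨z.2.1, ?_⟩, z.2.2⟩
  ext w
  simp only [singleton_sub, mem_inter_iff, mem_image, mem_singleton_iff]
  constructor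
  · rintro ⟨⟨k, hk, rfl⟩, hwA⟩
    have h1 : z.1 - (z.1 - k) ∈ K := by simpa using hk
    have h2 := hz ⟨z.1 - k, hwA, htr _ _ _ z.2.2 h1⟩ h1
    have h3 : k ∈ K ∩ (-K) := ⟨hk, by simpa using h2⟩
    rw [hKpointed] at h3
    rw [mem_singleton_iff.1 h3, sub_zero]
  · rintro rfl
    exact ⟨⟨0, h0, sub_zero _⟩, z.2.1⟩

theorem stmt6 (n m : ℕ)
    (Ω : Set (Fin n → ℝ)) (F : (Fin n → ℝ) → Set (Fin m → ℝ))
    (K : Set (Fin m → ℝ)) (e : Fin m → ℝ)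
    (hΩne : Ω.Nonempty) (hΩcl : IsClosed Ω)
    (hdom : ∀ x ∈ Ω, (F x).Nonempty) (hFcpt : ∀ x ∈ Ω, IsCompact (F x))
    (hKcl : IsClosed K) (hKconv : Convex ℝ K)
    (hKcone : ∀ t : ℝ, 0 ≤ t → ∀ y ∈ K, t • y ∈ K)
    (hKpointed : K ∩ (-K) = {0})
    (he : e ∈ interior K)
    (p : ℕ) (hp : 1 ≤ p) :
    (∀ xb ∈ VPwX Ω F K e p 0, ∃ yb : Fin p → Fin m → ℝ,
        (∀ i, yb i ∈ MinSet (F xb) K) ∧ VPwSol Ω F K e p 0 xb yb) ∧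
    (∀ (xb : Fin n → ℝ) (yb : Fin p → Fin m → ℝ),
        VPwSol Ω F K e p 0 xb yb → ∃ i, yb i ∈ WMinSet (F xb) K) := by
  have hadd : ∀ a ∈ K, ∀ b ∈ K, a + b ∈ K := by
    intro a ha b hb
    have h := hKconv ha hb (by norm_num : (0 : ℝ) ≤ 1 / 2) (by norm_num : (0 : ℝ) ≤ 1 / 2)
      (by norm_num)
    have h2 := hKcone 2 (by norm_num) _ h
    simpa [smul_add, smul_smul] using h2
  have hint : ∀ a ∈ K, ∀ b ∈ interior K, a + b ∈ interior K := by
    intro a ha b hb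
    have h : a + b ∈ interior (K + K) := subset_interior_add_right (add_mem_add ha hb)
    refine interior_mono ?_ h
    rintro _ ⟨u, hu, v, hv, rfl⟩
    exact hadd u hu v hv
  constructor
  · rintro xb ⟨y0, ⟨hxb, hy0⟩, hno⟩
    choose z hz hyz using fun i =>
      exists_minSet_below (F xb) K (hFcpt xb hxb) hKcl hadd hKpointed (y0 i) (hy0 i)
    refine ⟨z, hz, ⟨hxb, fun i => (hz i).1⟩, ?_⟩
    rintro ⟨x, y, hf, hlt⟩
    refine hno ⟨x, y, hf, fun i => ?_⟩
    have := hint _ (hyz i) _ (hlt i)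
    simpa using this
  · rintro xb yb ⟨⟨hxb, hyb⟩, hno⟩
    by_contra! hcon
    have hex : ∀ i, ∃ w ∈ F xb, yb i - w ∈ interior K := by
      intro i
      by_contra! hw
      refine hcon i ⟨hyb i, ?_⟩
      rw [eq_empty_iff_forall_notMem]
      rintro w ⟨hw1, hwF⟩
      rw [singleton_sub] at hw1
      obtain ⟨k, hk, rfl⟩ := hw1
      exact hw _ hwF (by simpa using hk)
    choose w hwF hw using hex
    exact hno ⟨xb, w, ⟨hxb, hwF⟩, fun i => by simpa using hw i⟩
end
end

section
/- Let p ∈ ℕ (p ≥ 1). (a) For every x̄ ∈ argmin_x(VP_p) there exist ȳ¹,…,ȳᵖ ∈ Min(F(x̄),K) such that (x̄,ȳ¹,…,ȳᵖ) is a minimal solution of (VP_p). (b) Conversely, if (x̄,ȳ¹,…,ȳᵖ) is a minimal solution of (VP_p), then ȳⁱ ∈ Min(F(x̄),K) for every index i ∈ {1,…,p}. -/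
open Set Pointwise

noncomputable section

theorem stmt7 (n m : ℕ)
    (Ω : Set (Fin n → ℝ)) (F : (Fin n → ℝ) → Set (Fin m → ℝ))
    (K : Set (Fin m → ℝ)) (e : Fin m → ℝ)
    (hΩne : Ω.Nonempty) (hΩcl : IsClosed Ω)
    (hdom : ∀ x ∈ Ω, (F x).Nonempty) (hFcpt : ∀ x ∈ Ω, IsCompact (F x))
    (hKcl : IsClosed K) (hKconv : Convex ℝ K)
    (hKcone : ∀ t : ℝ, 0 ≤ t → ∀ y ∈ K, t • y ∈ K)
    (hKpointed : K ∩ (-K) = {0})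
    (he : e ∈ interior K)
    (p : ℕ) (hp : 1 ≤ p) :
    (∀ xb ∈ VPmX Ω F K e p 0, ∃ yb : Fin p → Fin m → ℝ,
        (∀ i, yb i ∈ MinSet (F xb) K) ∧ VPmSol Ω F K e p 0 xb yb) ∧
    (∀ (xb : Fin n → ℝ) (yb : Fin p → Fin m → ℝ),
        VPmSol Ω F K e p 0 xb yb → ∀ i, yb i ∈ MinSet (F xb) K) := by
  have h0 : (0 : Fin m → ℝ) ∈ K := by
    have h : (0 : Fin m → ℝ) ∈ K ∩ (-K) := by rw [hKpointed]; rfl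
    exact h.1
  have hb : ∀ (xb : Fin n → ℝ) (yb : Fin p → Fin m → ℝ),
      VPmSol Ω F K e p 0 xb yb → ∀ i, yb i ∈ MinSet (F xb) K := by
    intro xb yb h i
    obtain ⟨⟨hx, hy⟩, hno⟩ := h
    refine ⟨hy i, ?_⟩
    ext z
    constructor
    · rintro ⟨hz, hzF⟩
      obtain ⟨a, ha, k, hk, hak⟩ := Set.mem_sub.1 hz
      rw [Set.mem_singleton_iff] at ha
      subst ha
      by_contra hne
      apply hno
      refine ⟨xb, Function.update yb i z, ⟨hx, ?_⟩, ?_, ?_⟩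
      · intro j
        by_cases hj : j = i
        · subst hj; simpa using hzF
        · simpa [hj] using hy j
      · intro j
        by_cases hj : j = i
        · subst hj
          have : yb j - z = k := by rw [← hak]; abel
          simpa [this] using hk
        · simpa [hj] using h0
      · intro heq
        apply hne
        have := congrFun heq i
        simpa using this
    · intro hz
      rw [Set.mem_singleton_iff] at hz
      subst hz
      exact ⟨Set.mem_sub.2 ⟨yb i, rfl, 0, h0, sub_zero _⟩, hy i⟩
  exact ⟨fun xb ⟨yb, h⟩ => ⟨yb, hb xb yb h, h⟩, hb⟩
end
end

section
/- The following relations hold: ⋃_{p∈ℕ, p≥1} wargmin_x(VP_p) ⊆ wargmin(SP), and wargmin(SP) = ⋂_{ε>0} ⋃_{p∈ℕ, p≥1} ε-wargmin_x(VP_p). -/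
open Set Pointwise

noncomputable section

lemma aux_smul_int {m : ℕ} {K : Set (Fin m → ℝ)}
    (hKcone : ∀ t : ℝ, 0 ≤ t → ∀ y ∈ K, t • y ∈ K) {t : ℝ} (ht : 0 < t)
    {y : Fin m → ℝ} (hy : y ∈ interior K) : t • y ∈ interior K := by
  have h : t • interior K ⊆ interior K := by
    apply interior_maximal
    · rintro _ ⟨z, hz, rfl⟩
      exact hKcone t ht.le z (interior_subset hz)
    · exact isOpen_interior.smul₀ ht.ne'
  exact h (smul_mem_smul_set hy)

lemma aux_add_int {m : ℕ} {K : Set (Fin m → ℝ)} (hKconv : Convex ℝ K)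
    (hKcone : ∀ t : ℝ, 0 ≤ t → ∀ y ∈ K, t • y ∈ K)
    {y z : Fin m → ℝ} (hy : y ∈ interior K) (hz : z ∈ interior K) :
    y + z ∈ interior K := by
  have h : interior K + interior K ⊆ interior K := by
    apply interior_maximal
    · rintro _ ⟨a, ha, b, hb, rfl⟩
      have h1 := hKconv (interior_subset ha) (interior_subset hb)
        (by norm_num : (0 : ℝ) ≤ 1 / 2) (by norm_num : (0 : ℝ) ≤ 1 / 2) (by norm_num)
      have h2 := hKcone 2 (by norm_num) _ h1
      have h3 : (2 : ℝ) • ((1 / 2 : ℝ) • a + (1 / 2 : ℝ) • b) = a + b := by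
        rw [smul_add, smul_smul, smul_smul]; norm_num
      rw [h3] at h2
      exact h2
    · exact isOpen_interior.add_left
  exact h (add_mem_add hy hz)

lemma aux_VP_sub_SP {n m : ℕ} (Ω : Set (Fin n → ℝ)) (F : (Fin n → ℝ) → Set (Fin m → ℝ))
    (K : Set (Fin m → ℝ)) (e : Fin m → ℝ) (p : ℕ) (ε : ℝ) :
    VPwX Ω F K e p ε ⊆ SPwmin Ω F K e ε := by
  rintro xb ⟨yb, ⟨hx, hy⟩, hno⟩
  refine ⟨hx, ?_⟩
  rintro ⟨x, hxΩ, hsub⟩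
  apply hno
  have h : ∀ i, ∃ y ∈ F x, (yb i - ε • e) - y ∈ interior K := by
    intro i
    obtain ⟨a, ha, b, hb, hab⟩ := hsub ⟨yb i, hy i, rfl⟩
    refine ⟨a, ha, ?_⟩
    have : yb i - ε • e - a = b := by
      rw [← show a + b = yb i - ε • e from hab]; abel
    rw [this]; exact hb
  choose y hyF hyK using h
  exact ⟨x, y, ⟨hxΩ, hyF⟩, hyK⟩

theorem stmt8 (n m : ℕ)
    (Ω : Set (Fin n → ℝ)) (F : (Fin n → ℝ) → Set (Fin m → ℝ))
    (K : Set (Fin m → ℝ)) (e : Fin m → ℝ)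
    (hΩne : Ω.Nonempty) (hΩcl : IsClosed Ω)
    (hdom : ∀ x ∈ Ω, (F x).Nonempty) (hFcpt : ∀ x ∈ Ω, IsCompact (F x))
    (hKcl : IsClosed K) (hKconv : Convex ℝ K)
    (hKcone : ∀ t : ℝ, 0 ≤ t → ∀ y ∈ K, t • y ∈ K)
    (hKpointed : K ∩ (-K) = {0})
    (he : e ∈ interior K) :
    (⋃ (p : ℕ) (_ : 1 ≤ p), VPwX Ω F K e p 0) ⊆ SPwmin Ω F K e 0 ∧
    SPwmin Ω F K e 0 =
      ⋂ (ε : ℝ) (_ : 0 < ε), ⋃ (p : ℕ) (_ : 1 ≤ p), VPwX Ω F K e p ε := by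
  refine ⟨?_, ?_⟩
  · intro xb hxb
    simp only [mem_iUnion] at hxb
    obtain ⟨p, _, h⟩ := hxb
    exact aux_VP_sub_SP Ω F K e p 0 h
  apply Subset.antisymm
  · rintro xb ⟨hxb, hno⟩
    simp only [mem_iInter, mem_iUnion]
    intro ε hε
    have hεe : ε • e ∈ interior K := aux_smul_int hKcone hε he
    obtain ⟨t, htF, htc⟩ := (hFcpt xb hxb).elim_nhds_subcover
      (fun z => {y | y - z + ε • e ∈ interior K}) (by
        intro z _
        apply IsOpen.mem_nhds
        · exact isOpen_interior.preimage (by fun_prop)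
        · simpa using hεe)
    have hcov : ∀ y ∈ F xb, ∃ z ∈ t, y - z + ε • e ∈ interior K := by
      intro y hy
      have := htc hy
      simpa only [mem_iUnion, exists_prop, mem_setOf_eq] using this
    refine ⟨t.card, ?_, fun i => (t.equivFin.symm i : Fin m → ℝ), ⟨hxb, fun i => htF _ (t.equivFin.symm i).2⟩, ?_⟩
    · obtain ⟨y, hy⟩ := hdom xb hxb
      obtain ⟨z, hz, _⟩ := hcov y hy
      exact Finset.card_pos.mpr ⟨z, hz⟩
    · rintro ⟨x, y, ⟨hx, hyF⟩, hyK⟩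
      refine hno ⟨x, hx, ?_⟩
      rintro _ ⟨w, hw, rfl⟩
      obtain ⟨z, hz, hzK⟩ := hcov w hw
      have h1 := hyK (t.equivFin ⟨z, hz⟩)
      simp only [Equiv.symm_apply_apply] at h1
      refine ⟨y (t.equivFin ⟨z, hz⟩), hyF _, _, aux_add_int hKconv hKcone h1 hzK, ?_⟩
      simp only [zero_smul]
      abel
  · intro xb hxb
    simp only [mem_iInter, mem_iUnion] at hxb
    have hSP : ∀ ε : ℝ, 0 < ε → xb ∈ SPwmin Ω F K e ε := by
      intro ε hε
      obtain ⟨p, _, h⟩ := hxb ε hε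
      exact aux_VP_sub_SP Ω F K e p ε h
    have hxΩ : xb ∈ Ω := (hSP 1 one_pos).1
    refine ⟨hxΩ, ?_⟩
    rintro ⟨x, hx, hsub⟩
    have hsub' : F xb ⊆ F x + interior K := by
      intro y hy
      exact hsub ⟨y, hy, by simp⟩
    obtain ⟨δ, hδ, hth⟩ := (hFcpt xb hxΩ).exists_thickening_subset_open
      (isOpen_interior.add_left) hsub'
    have hpos : 0 < ‖e‖ + 1 := by positivity
    have hε : 0 < δ / (‖e‖ + 1) := by positivity
    refine (hSP _ hε).2 ⟨x, hx, ?_⟩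
    rintro _ ⟨y, hy, rfl⟩
    apply hth
    rw [Metric.mem_thickening_iff]
    refine ⟨y, hy, ?_⟩
    rw [dist_eq_norm]
    have : y - (δ / (‖e‖ + 1)) • e - y = -((δ / (‖e‖ + 1)) • e) := by abel
    simp only [this, norm_neg, norm_smul, Real.norm_eq_abs, abs_of_pos hε]
    rw [div_mul_eq_mul_div, div_lt_iff₀ hpos]
    nlinarith
end
end

section
/- The following relations hold: ⋃_{p∈ℕ, p≥1} argmin_x(VP_p) ⊆ argmin₂(SP) ⊆ ⋂_{ε>0} ⋃_{p∈ℕ, p≥1} ε-argmin_x(VP_p). -/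
open Set Pointwise

noncomputable section

theorem stmt9 (n m : ℕ)
    (Ω : Set (Fin n → ℝ)) (F : (Fin n → ℝ) → Set (Fin m → ℝ))
    (K : Set (Fin m → ℝ)) (e : Fin m → ℝ)
    (hΩne : Ω.Nonempty) (hΩcl : IsClosed Ω)
    (hdom : ∀ x ∈ Ω, (F x).Nonempty) (hFcpt : ∀ x ∈ Ω, IsCompact (F x))
    (hKcl : IsClosed K) (hKconv : Convex ℝ K)
    (hKcone : ∀ t : ℝ, 0 ≤ t → ∀ y ∈ K, t • y ∈ K)
    (hKpointed : K ∩ (-K) = {0})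
    (he : e ∈ interior K) :
    (⋃ (p : ℕ) (_ : 1 ≤ p), VPmX Ω F K e p 0) ⊆ SPargmin2 Ω F K e 0 ∧
    SPargmin2 Ω F K e 0 ⊆
      ⋂ (ε : ℝ) (_ : 0 < ε), ⋃ (p : ℕ) (_ : 1 ≤ p), VPmX Ω F K e p ε := by
  have hadd : ∀ a ∈ K, ∀ b ∈ K, a + b ∈ K := by
    intro a ha b hb
    have h := hKconv ha hb (by norm_num : (0 : ℝ) ≤ 1 / 2) (by norm_num : (0 : ℝ) ≤ 1 / 2)
      (by norm_num)
    have h2 := hKcone 2 (by norm_num) _ h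
    have h3 : (2 : ℝ) • ((1 / 2 : ℝ) • a + (1 / 2 : ℝ) • b) = a + b := by
      rw [smul_add, smul_smul, smul_smul]; norm_num
    rwa [h3] at h2
  constructor
  · intro xb hxb
    simp only [mem_iUnion] at hxb
    obtain ⟨p, hp, yb, ⟨hxΩ, hyb⟩, hno⟩ := hxb
    refine ⟨hxΩ, ?_⟩
    rintro ⟨x, hx, hsub⟩
    have key : ∀ i, ∃ y, y ∈ F x ∧ yb i - y ∈ K ∧ yb i ≠ y := by
      intro i
      have h1 : yb i ∈ shiftSet (F xb) ((0 : ℝ) • e) := ⟨yb i, hyb i, by simp⟩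
      obtain ⟨y, hy, k, ⟨hk, hk0⟩, hyk⟩ := hsub h1
      have hyk' : y + k = yb i := hyk
      refine ⟨y, hy, ?_, ?_⟩
      · rw [← hyk']; simpa using hk
      · intro h
        apply hk0
        rw [h] at hyk'
        simpa using hyk'
    choose y hyF hyK hne using key
    apply hno
    refine ⟨x, y, ⟨hx, hyF⟩, fun i => by simpa using hyK i, ?_⟩
    intro h
    have h0 := congrFun h ⟨0, hp⟩
    apply hne ⟨0, hp⟩
    simpa using h0.symm
  · rintro xb ⟨hxΩ, hno⟩
    simp only [mem_iInter, mem_iUnion]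
    intro ε hε
    have heε : ε • e ∈ interior K := by
      have h1 : ε • e ∈ ε • interior K := smul_mem_smul_set he
      rw [← interior_smul₀ hε.ne'] at h1
      refine interior_mono ?_ h1
      rintro _ ⟨k, hk, rfl⟩
      exact hKcone ε hε.le k hk
    have hnhds : ∀ w ∈ F xb, {z | z - (w - ε • e) ∈ interior K} ∈ nhds w := by
      intro w _
      have ho : IsOpen {z : Fin m → ℝ | z - (w - ε • e) ∈ interior K} :=
        isOpen_interior.preimage (by fun_prop : Continuous fun z : Fin m → ℝ => z - (w - ε • e))
      exact ho.mem_nhds (by simpa using heε)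
    obtain ⟨t, htF, hcov⟩ := (hFcpt xb hxΩ).elim_nhds_subcover _ hnhds
    obtain ⟨w₀, hw₀⟩ := hdom xb hxΩ
    have htne : 1 ≤ t.card := by
      have h := hcov hw₀
      simp only [mem_iUnion] at h
      obtain ⟨w, hw, _⟩ := h
      exact Finset.card_pos.mpr ⟨w, hw⟩
    refine ⟨t.card, htne, fun i => (t.equivFin.symm i : Fin m → ℝ),
      ⟨hxΩ, fun i => htF _ (t.equivFin.symm i).2⟩, ?_⟩
    rintro ⟨x, y, ⟨hx, hyF⟩, hyK, hne⟩
    have h0 : (0 : Fin m → ℝ) ∉ interior K := by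
      intro h0
      cases m with
      | zero => exact hne (Subsingleton.elim _ _)
      | succ m =>
        have hK0 : K ∈ nhds (0 : Fin (m + 1) → ℝ) := mem_interior_iff_mem_nhds.mp h0
        have hnK0 : -K ∈ nhds (0 : Fin (m + 1) → ℝ) := by
          have := neg_mem_nhds_zero _ hK0
          simpa using this
        have hs := Filter.inter_mem hK0 hnK0
        rw [hKpointed] at hs
        have hbot : (nhdsWithin (0 : Fin (m + 1) → ℝ) {0}ᶜ).NeBot :=
          Module.punctured_nhds_neBot ℝ _ 0
        rw [← mem_interior_iff_mem_nhds, interior_singleton] at hs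
        exact hs
    apply hno
    refine ⟨x, hx, ?_⟩
    rintro _ ⟨z, hz, rfl⟩
    have h := hcov hz
    simp only [mem_iUnion] at h
    obtain ⟨w, hw, hzw⟩ := h
    have hzw : z - (w - ε • e) ∈ interior K := hzw
    have hk := hyK (t.equivFin ⟨w, hw⟩)
    simp only [Equiv.symm_apply_apply] at hk
    set v := y (t.equivFin ⟨w, hw⟩) with hv
    have hvF : v ∈ F x := hyF _
    have hsum := hadd _ (interior_subset hzw) _ hk
    have heq : z - (w - ε • e) + (w - ε • e - v) = z - v := by abel
    refine ⟨v, hvF, z - v, ⟨heq ▸ hsum, ?_⟩, ?_⟩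
    · intro hzv
      have hzv : z - v = 0 := hzv
      have hmem : z - (w - ε • e) ∈ K ∩ (-K) := by
        refine ⟨interior_subset hzw, ?_⟩
        rw [Set.mem_neg]
        have : -(z - (w - ε • e)) = w - ε • e - v := by
          rw [hzv] at heq
          exact neg_eq_of_add_eq_zero_right heq
        rw [this]; exact hk
      rw [hKpointed] at hmem
      have hmem : z - (w - ε • e) = 0 := hmem
      rw [hmem] at hzw
      exact h0 hzw
    · simp
end
end

section
/- Suppose that the image set F(wargmin(SP)) := ⋃_{x ∈ wargmin(SP)} F(x) is bounded. Then for every ε > 0 there exists p ∈ ℕ (p ≥ 1) such that wargmin_x(VP_p) ⊆ wargmin(SP) ⊆ ε-wargmin_x(VP_p). -/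
open Set Pointwise

noncomputable section

theorem stmt10 (n m : ℕ)
    (Ω : Set (Fin n → ℝ)) (F : (Fin n → ℝ) → Set (Fin m → ℝ))
    (K : Set (Fin m → ℝ)) (e : Fin m → ℝ)
    (hΩne : Ω.Nonempty) (hΩcl : IsClosed Ω)
    (hdom : ∀ x ∈ Ω, (F x).Nonempty) (hFcpt : ∀ x ∈ Ω, IsCompact (F x))
    (hKcl : IsClosed K) (hKconv : Convex ℝ K)
    (hKcone : ∀ t : ℝ, 0 ≤ t → ∀ y ∈ K, t • y ∈ K)
    (hKpointed : K ∩ (-K) = {0})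
    (he : e ∈ interior K)
    (hbd : Bornology.IsBounded (⋃ x ∈ SPwmin Ω F K e 0, F x)) :
    ∀ ε : ℝ, 0 < ε → ∃ p : ℕ, 1 ≤ p ∧
      VPwX Ω F K e p 0 ⊆ SPwmin Ω F K e 0 ∧
      SPwmin Ω F K e 0 ⊆ VPwX Ω F K e p ε := by
  intro ε hε
  have hcone : ∀ t : ℝ, 0 < t → ∀ y ∈ interior K, t • y ∈ interior K := by
    intro t ht y hy
    have h1 : t • interior K ⊆ interior K := by
      rw [← interior_smul₀ ht.ne']
      apply interior_mono
      rintro _ ⟨z, hz, rfl⟩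
      exact hKcone t ht.le z hz
    exact h1 ⟨y, hy, rfl⟩
  have hadd : ∀ a ∈ interior K, ∀ b ∈ interior K, a + b ∈ interior K := by
    intro a ha b hb
    have h := hKconv.interior ha hb (a := 1/2) (b := 1/2) (by norm_num) (by norm_num) (by norm_num)
    have h2 := hcone 2 (by norm_num) _ h
    rw [smul_add, smul_smul, smul_smul] at h2
    norm_num at h2
    exact h2
  obtain ⟨δ, hδ, hball⟩ := Metric.isOpen_iff.1 isOpen_interior (ε • e) (hcone ε hε e he)
  obtain ⟨t, htfin, ht⟩ := Metric.totallyBounded_iff.1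
    (hbd.isCompact_closure.totallyBounded.subset subset_closure) (δ / 2) (by positivity)
  classical
  obtain ⟨T, rfl⟩ := htfin.exists_finset_coe
  let c : Fin (T.card + 1) → (Fin m → ℝ) :=
    fun i => if h : (i : ℕ) < T.card then (T.equivFin.symm ⟨i, h⟩).1 else 0
  have hc : ∀ z ∈ T, ∃ i, c i = z := by
    intro z hz
    refine ⟨(T.equivFin ⟨z, hz⟩).castSucc, ?_⟩
    simp [c]
  refine ⟨T.card + 1, by omega, ?_, ?_⟩
  · rintro xb ⟨yb, ⟨hxb, hyb⟩, hno⟩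
    refine ⟨hxb, ?_⟩
    rintro ⟨x, hx, hsub⟩
    apply hno
    have : ∀ i, ∃ y ∈ F x, (yb i - (0 : ℝ) • e) - y ∈ interior K := by
      intro i
      obtain ⟨y, hy, k, hk, hyk⟩ := hsub ⟨yb i, hyb i, rfl⟩
      refine ⟨y, hy, ?_⟩
      have : (yb i - (0 : ℝ) • e) - y = k := by
        rw [← show y + k = yb i - (0 : ℝ) • e from hyk]; abel
      rwa [this]
    choose y hy hk using this
    exact ⟨x, y, ⟨hx, hy⟩, hk⟩
  · rintro xb hxb
    have hxb' := hxb
    obtain ⟨hxΩ, hno⟩ := hxb'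
    have : ∀ i, ∃ y ∈ F xb, (∃ z ∈ F xb, z ∈ Metric.ball (c i) (δ / 2)) →
        y ∈ Metric.ball (c i) (δ / 2) := by
      intro i
      by_cases h : ∃ z ∈ F xb, z ∈ Metric.ball (c i) (δ / 2)
      · obtain ⟨z, hz, hz'⟩ := h
        exact ⟨z, hz, fun _ => hz'⟩
      · obtain ⟨z, hz⟩ := hdom xb hxΩ
        exact ⟨z, hz, fun h' => absurd h' h⟩
    choose yb hyb hyb' using this
    refine ⟨yb, ⟨hxΩ, hyb⟩, ?_⟩
    rintro ⟨x, y, ⟨hx, hy⟩, hk⟩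
    apply hno
    refine ⟨x, hx, ?_⟩
    rintro _ ⟨z, hz, rfl⟩
    have hzU := ht (mem_biUnion hxb hz)
    simp only [mem_iUnion] at hzU
    obtain ⟨w, hw, hzw⟩ := hzU
    obtain ⟨i, rfl⟩ := hc w (by simpa using hw)
    have h1 := hyb' i ⟨z, hz, hzw⟩
    have hd : dist z (yb i) < δ := by
      have := dist_triangle_right z (yb i) (c i)
      rw [Metric.mem_ball] at h1 hzw
      linarith
    have h2 : ε • e + (z - yb i) ∈ interior K := by
      apply hball
      rw [Metric.mem_ball, dist_eq_norm, add_sub_cancel_left, ← dist_eq_norm]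
      exact hd
    refine ⟨y i, hy i, _, hadd _ (hk i) _ h2, ?_⟩
    simp only [zero_smul, sub_zero]
    abel
end
end

section
/- Suppose that the image set F(argmin₂(SP)) := ⋃_{x ∈ argmin₂(SP)} F(x) is bounded. Then for every ε > 0 there exists p ∈ ℕ (p ≥ 1) such that argmin_x(VP_p) ⊆ argmin₂(SP) ⊆ ε-argmin_x(VP_p). -/
open Set Pointwise

noncomputable section

theorem stmt11 (n m : ℕ)
    (Ω : Set (Fin n → ℝ)) (F : (Fin n → ℝ) → Set (Fin m → ℝ))
    (K : Set (Fin m → ℝ)) (e : Fin m → ℝ)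
    (hΩne : Ω.Nonempty) (hΩcl : IsClosed Ω)
    (hdom : ∀ x ∈ Ω, (F x).Nonempty) (hFcpt : ∀ x ∈ Ω, IsCompact (F x))
    (hKcl : IsClosed K) (hKconv : Convex ℝ K)
    (hKcone : ∀ t : ℝ, 0 ≤ t → ∀ y ∈ K, t • y ∈ K)
    (hKpointed : K ∩ (-K) = {0})
    (he : e ∈ interior K)
    (hbd : Bornology.IsBounded (⋃ x ∈ SPargmin2 Ω F K e 0, F x)) :
    ∀ ε : ℝ, 0 < ε → ∃ p : ℕ, 1 ≤ p ∧
      VPmX Ω F K e p 0 ⊆ SPargmin2 Ω F K e 0 ∧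
      SPargmin2 Ω F K e 0 ⊆ VPmX Ω F K e p ε := by
  intro ε hε
  have hadd : ∀ a ∈ K, ∀ b ∈ K, a + b ∈ K := by
    intro a ha b hb
    have h := hKconv ha hb (by norm_num : (0:ℝ) ≤ 1/2) (by norm_num : (0:ℝ) ≤ 1/2) (by norm_num)
    have h2 := hKcone 2 (by norm_num) _ h
    have h3 : (2:ℝ) • ((1/2:ℝ) • a + (1/2:ℝ) • b) = a + b := by
      rw [smul_add, smul_smul, smul_smul]; norm_num
    rwa [h3] at h2
  have hpt : ∀ a, a ∈ K → -a ∈ K → a = 0 := by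
    intro a h1 h2
    have h : a ∈ K ∩ (-K) := ⟨h1, by simpa using h2⟩
    rw [hKpointed] at h
    simpa using h
  -- First inclusion, for every `p ≥ 1`
  have first : ∀ p : ℕ, 1 ≤ p → VPmX Ω F K e p 0 ⊆ SPargmin2 Ω F K e 0 := by
    rintro p hp xb ⟨yb, ⟨hx, hy⟩, hmin⟩
    refine ⟨hx, ?_⟩
    rintro ⟨x, hxΩ, hsub⟩
    apply hmin
    have key : ∀ i, ∃ y ∈ F x, yb i - y ∈ K ∧ y ≠ yb i := by
      intro i
      have h1 : yb i ∈ F x + (K \ {0}) := hsub ⟨yb i, hy i, by simp⟩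
      obtain ⟨y, hyF, k, ⟨hk, hk0⟩, hyk⟩ := Set.mem_add.1 h1
      refine ⟨y, hyF, ?_, ?_⟩
      · rw [← hyk]; simpa using hk
      · intro h
        apply hk0
        rw [← h] at hyk
        simpa using hyk
    choose y hyF hyK hyne using key
    refine ⟨x, y, ⟨hxΩ, hyF⟩, ?_, ?_⟩
    · intro i; simpa using hyK i
    · intro h
      have := congrFun h ⟨0, hp⟩
      exact hyne ⟨0, hp⟩ (by simpa using this)
  by_cases hemp : (SPargmin2 Ω F K e 0).Nonempty
  swap
  · refine ⟨1, le_rfl, first 1 le_rfl, ?_⟩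
    intro x hx
    exact absurd ⟨x, hx⟩ hemp
  -- choice of the mesh
  have hδ : ∃ δ > 0, ∀ w : Fin m → ℝ, ‖w‖ < δ → w + ε • e ∈ K := by
    obtain ⟨r, hr, hball⟩ := Metric.mem_nhds_iff.1 (mem_interior_iff_mem_nhds.1 he)
    refine ⟨ε * r, by positivity, ?_⟩
    intro w hw
    have h1 : e + ε⁻¹ • w ∈ K := by
      apply hball
      rw [mem_ball_iff_norm, add_sub_cancel_left, norm_smul, norm_inv, Real.norm_of_nonneg hε.le,
        inv_mul_lt_iff₀ hε]
      exact hw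
    have h2 := hKcone ε hε.le _ h1
    rw [smul_add, smul_smul, mul_inv_cancel₀ hε.ne', one_smul, add_comm] at h2
    exact h2
  have hδ' : ∃ δ > 0, (∀ w : Fin m → ℝ, ‖w‖ < δ → w + ε • e ∈ K) ∧
      (e ≠ 0 → δ ≤ ‖ε • e‖) := by
    obtain ⟨δ, h0, h⟩ := hδ
    by_cases he0 : e = 0
    · exact ⟨δ, h0, h, fun h => absurd he0 h⟩
    · have : 0 < ‖ε • e‖ := norm_pos_iff.2 (smul_ne_zero hε.ne' he0)
      exact ⟨min δ ‖ε • e‖, lt_min h0 this,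
        fun w hw => h w (hw.trans_le (min_le_left _ _)), fun _ => min_le_right _ _⟩
  obtain ⟨δ, hδ0, hδK, hδe⟩ := hδ'
  have htriv : e = 0 → ∀ v : Fin m → ℝ, v = 0 := by
    intro he0 v
    have hpos : 0 < δ / (‖v‖ + 1) := by positivity
    have hlt : ‖(δ / (‖v‖ + 1)) • v‖ < δ := by
      rw [norm_smul, Real.norm_of_nonneg hpos.le, div_mul_eq_mul_div, div_lt_iff₀ (by positivity)]
      nlinarith [norm_nonneg v]
    have h1 := hδK _ hlt
    have h2 := hδK (-((δ / (‖v‖ + 1)) • v)) (by rwa [norm_neg])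
    rw [he0, smul_zero, add_zero] at h1 h2
    exact (smul_eq_zero.1 (hpt _ h1 h2)).resolve_left hpos.ne'
  obtain ⟨t, htfin, ht⟩ := Metric.totallyBounded_iff.1 (hbd.isCompact_closure.totallyBounded.subset subset_closure) (δ / 2) (by positivity)
  obtain ⟨p, c, hc⟩ := htfin.fin_param
  obtain ⟨-, hc⟩ := hc
  have hcell : ∀ xb ∈ SPargmin2 Ω F K e 0, ∀ z ∈ F xb, ∃ i, dist z (c i) < δ / 2 := by
    intro xb hxb z hz
    have h := ht (Set.mem_biUnion hxb hz)
    simp only [Set.mem_iUnion, Metric.mem_ball] at h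
    obtain ⟨y, hyt, hd⟩ := h
    rw [← hc] at hyt
    obtain ⟨i, rfl⟩ := hyt
    exact ⟨i, hd⟩
  have hp : 1 ≤ p := by
    obtain ⟨xb, hxb⟩ := hemp
    obtain ⟨z, hz⟩ := hdom xb hxb.1
    obtain ⟨i, -⟩ := hcell xb hxb z hz
    exact i.pos
  refine ⟨p, hp, first p hp, ?_⟩
  intro xb hxb
  have hch : ∀ i, ∃ y ∈ F xb, ∀ z ∈ F xb, dist z (c i) < δ / 2 → dist z y < δ := by
    intro i
    by_cases h : ∃ y ∈ F xb, dist y (c i) < δ / 2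
    · obtain ⟨y, hy, hd⟩ := h
      refine ⟨y, hy, fun z _ hzd => ?_⟩
      linarith [dist_triangle_right z y (c i)]
    · obtain ⟨y, hy⟩ := hdom xb hxb.1
      exact ⟨y, hy, fun z hz hzd => absurd ⟨z, hz, hzd⟩ h⟩
  choose yb hybF hyb using hch
  refine ⟨yb, ⟨hxb.1, hybF⟩, ?_⟩
  rintro ⟨x, y, ⟨hxΩ, hyF⟩, hK, hne⟩
  have he0 : e ≠ 0 := by
    intro he0
    apply hne
    funext i
    rw [htriv he0 (y i), ← htriv he0 (yb i - ε • e)]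
  apply hxb.2
  refine ⟨x, hxΩ, ?_⟩
  rintro _ ⟨z, hz, rfl⟩
  obtain ⟨i, hi⟩ := hcell xb hxb z hz
  have hd := hyb i z hz hi
  rw [dist_eq_norm] at hd
  have h1 := hδK _ hd
  have hsum : z - y i = (z - yb i + ε • e) + (yb i - ε • e - y i) := by abel
  refine Set.mem_add.2 ⟨y i, hyF i, z - y i, ⟨?_, ?_⟩, by simp⟩
  · rw [hsum]; exact hadd _ h1 _ (hK i)
  · intro h
    have h0 : z - y i = 0 := h
    rw [hsum] at h0
    have h2 : -(z - yb i + ε • e) ∈ K := by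
      rw [neg_eq_of_add_eq_zero_right h0]; exact hK i
    have h3 := hpt _ h1 h2
    have h4 : ‖z - yb i‖ = ‖ε • e‖ := by
      rw [eq_neg_of_add_eq_zero_left h3, norm_neg]
    linarith [hδe he0]
end
end

section
/- Suppose that Ω is compact, that F(Ω) := ⋃_{x∈Ω} F(x) is bounded, and that the graph gph F := {(x,y) | y ∈ F(x)} is closed. Then for every x ∈ Ω there exists x̄ in the closure of ⋃_{p∈ℕ, p≥1} argmin_x(VP_p) such that F(x̄) ≼ℓ_K F(x), i.e. F(x) ⊆ F(x̄) + K. -/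
open Set Pointwise

noncomputable section

theorem exists_max_of_closed_rel {X : Type*} [TopologicalSpace X] [CompactSpace X] [Nonempty X]
    (r : X → X → Prop) (hrefl : ∀ a, r a a) (htrans : ∀ a b c, r a b → r b c → r a c)
    (hcl : ∀ a, IsClosed {b | r a b}) : ∃ m, ∀ a, r m a → r a m := by
  refine exists_maximal_of_chains_bounded (r := r) ?_ (fun {a b c} => htrans a b c)
  intro c hc
  rcases c.eq_empty_or_nonempty with rfl | hne
  · exact ⟨Classical.arbitrary X, by simp⟩
  · have : Nonempty c := hne.to_subtype
    have h := IsCompact.nonempty_iInter_of_directed_nonempty_isCompact_isClosed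
      (fun a : c => {b | r a.1 b}) ?_ (fun a => ⟨a.1, hrefl _⟩)
      (fun a => (hcl a.1).isCompact) (fun a => hcl a.1)
    · obtain ⟨b, hb⟩ := h
      rw [mem_iInter] at hb
      exact ⟨b, fun a ha => hb ⟨a, ha⟩⟩
    · intro a b
      by_cases hab : a.1 = b.1
      · exact ⟨a, fun x hx => hx, fun x hx => by
          have : r a.1 x := hx
          rw [hab] at this; exact this⟩
      · rcases hc a.2 b.2 hab with h | h
        · exact ⟨b, fun x hx => htrans _ _ _ h hx, fun x hx => hx⟩
        · exact ⟨a, fun x hx => hx, fun x hx => htrans _ _ _ h hx⟩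

theorem stmt12 (n m : ℕ)
    (Ω : Set (Fin n → ℝ)) (F : (Fin n → ℝ) → Set (Fin m → ℝ))
    (K : Set (Fin m → ℝ)) (e : Fin m → ℝ)
    (hΩne : Ω.Nonempty) (hΩcl : IsClosed Ω)
    (hdom : ∀ x ∈ Ω, (F x).Nonempty) (hFcpt : ∀ x ∈ Ω, IsCompact (F x))
    (hKcl : IsClosed K) (hKconv : Convex ℝ K)
    (hKcone : ∀ t : ℝ, 0 ≤ t → ∀ y ∈ K, t • y ∈ K)
    (hKpointed : K ∩ (-K) = {0})
    (he : e ∈ interior K)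
    (hΩcpt : IsCompact Ω)
    (hbd : Bornology.IsBounded (⋃ x ∈ Ω, F x))
    (hgph : IsClosed (gph F)) :
    ∀ x ∈ Ω, ∃ xb ∈ closure (⋃ (p : ℕ) (_ : 1 ≤ p), VPmX Ω F K e p 0),
      F x ⊆ F xb + K := by
  intro x hx
  have h0 : (0 : Fin m → ℝ) ∈ K := by
    simpa using hKcone 0 le_rfl e (interior_subset he)
  have hadd : ∀ a ∈ K, ∀ b ∈ K, a + b ∈ K := by
    intro a ha b hb
    have h := hKconv ha hb (a := 1/2) (b := 1/2) (by norm_num) (by norm_num) (by norm_num)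
    have h2 := hKcone 2 (by norm_num) _ h
    simpa [smul_smul] using h2
  have hanti : ∀ a, a ∈ K → -a ∈ K → a = 0 := by
    intro a h1 h2
    have : a ∈ K ∩ (-K) := ⟨h1, h2⟩
    rw [hKpointed] at this
    exact this
  set B := closure (⋃ x ∈ Ω, F x) with hB
  have hBc : IsCompact B := hbd.isCompact_closure
  have hFB : ∀ z ∈ Ω, ∀ y ∈ F z, y ∈ B := fun z hz y hy =>
    subset_closure (mem_biUnion hz hy)
  have key : ∀ (p : ℕ) (y : Fin p → Fin m → ℝ), (∀ i, y i ∈ F x) →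
      ∃ z ∈ VPmX Ω F K e p 0, ∀ i, ∃ w ∈ F z, y i - w ∈ K := by
    intro p y hy
    let S : Set ((Fin n → ℝ) × (Fin p → Fin m → ℝ)) :=
      {q | q.1 ∈ Ω ∧ ∀ i, q.2 i ∈ F q.1 ∧ y i - q.2 i ∈ K}
    have hScl : IsClosed S := by
      have hS : S = (Prod.fst ⁻¹' Ω) ∩ ⋂ i,
          ({q : (Fin n → ℝ) × (Fin p → Fin m → ℝ) | q.2 i ∈ F q.1} ∩
            {q : (Fin n → ℝ) × (Fin p → Fin m → ℝ) | y i - q.2 i ∈ K}) := by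
        ext q
        simp [S]
      rw [hS]
      refine (hΩcl.preimage continuous_fst).inter ?_
      refine isClosed_iInter fun i => IsClosed.inter ?_ ?_
      · exact hgph.preimage (f := fun q : (Fin n → ℝ) × (Fin p → Fin m → ℝ) => (q.1, q.2 i))
          (by fun_prop)
      · exact hKcl.preimage (f := fun q : (Fin n → ℝ) × (Fin p → Fin m → ℝ) => y i - q.2 i)
          (by fun_prop)
    have hSc : IsCompact S := by
      refine (hΩcpt.prod (isCompact_univ_pi (fun _ : Fin p => hBc))).of_isClosed_subset hScl ?_
      rintro ⟨z, w⟩ ⟨hz, hw⟩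
      exact ⟨hz, fun i _ => hFB z hz _ (hw i).1⟩
    have : CompactSpace S := isCompact_iff_compactSpace.mp hSc
    have : Nonempty S := ⟨⟨(x, y), hx, fun i => ⟨hy i, by simpa using h0⟩⟩⟩
    obtain ⟨⟨⟨z, w⟩, hz, hw⟩, hmax⟩ := exists_max_of_closed_rel
      (fun a b : S => ∀ i, a.1.2 i - b.1.2 i ∈ K) (fun a i => by simpa using h0)
      (fun a b c h1 h2 i => by simpa using hadd _ (h1 i) _ (h2 i))
      (fun a => by
        simp only [ofPred_forall]
        exact isClosed_iInter fun i =>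
          hKcl.preimage (f := fun b : S => a.1.2 i - b.1.2 i) (by fun_prop))
    refine ⟨z, ⟨w, ⟨hz, fun i => (hw i).1⟩, ?_⟩, fun i => ⟨w i, (hw i).1, (hw i).2⟩⟩
    rintro ⟨z', w', ⟨hz', hw'⟩, hle, hne⟩
    simp only [zero_smul, sub_zero] at hle hne
    have h := hmax ⟨(z', w'), hz', fun i => ⟨hw' i, by
      simpa using hadd _ (hw i).2 _ (hle i)⟩⟩ hle
    apply hne
    funext i
    have h1 : w' i - w i ∈ K := h i
    exact sub_eq_zero.mp (hanti _ h1 (by simpa using hle i))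
  set M := closure (⋃ (p : ℕ) (_ : 1 ≤ p), VPmX Ω F K e p 0) with hM
  have hMΩ : M ⊆ Ω := by
    refine closure_minimal ?_ hΩcl
    refine iUnion₂_subset fun p _ => ?_
    rintro z ⟨w, hw, _⟩
    exact hw.1
  have hMc : IsCompact M := hΩcpt.of_isClosed_subset isClosed_closure hMΩ
  let C : F x → Set (Fin n → ℝ) := fun y => {z | z ∈ Ω ∧ ∃ w ∈ F z, y.1 - w ∈ K}
  have hC : ∀ y, IsClosed (C y) := by
    intro y
    have h : IsCompact ((Ω ×ˢ B) ∩ (gph F ∩ {q | y.1 - q.2 ∈ K})) :=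
      (hΩcpt.prod hBc).inter_right (hgph.inter
        (hKcl.preimage (f := fun q : (Fin n → ℝ) × (Fin m → ℝ) => y.1 - q.2) (by fun_prop)))
    have h2 := (h.image continuous_fst).isClosed
    convert h2 using 1
    ext z
    constructor
    · rintro ⟨hz, w, hw, hk⟩
      exact ⟨(z, w), ⟨⟨hz, hFB z hz w hw⟩, hw, hk⟩, rfl⟩
    · rintro ⟨⟨z', w⟩, ⟨⟨hz, _⟩, hw, hk⟩, rfl⟩
      exact ⟨hz, w, hw, hk⟩
  have hne : (M ∩ ⋂ y, C y).Nonempty := by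
    refine hMc.inter_iInter_nonempty C hC fun u => ?_
    obtain ⟨y0, hy0⟩ := hdom x hx
    classical
    let v : Finset (F x) := insert ⟨y0, hy0⟩ u
    obtain ⟨z, hz, hzw⟩ := key v.card (fun i => ((v.equivFin.symm i).1 : F x).1)
      (fun i => ((v.equivFin.symm i).1 : F x).2)
    have hzM : z ∈ M := subset_closure (mem_iUnion₂.mpr
      ⟨v.card, Finset.card_pos.mpr (Finset.insert_nonempty _ _), hz⟩)
    refine ⟨z, hzM, mem_iInter₂.mpr fun y hy => ⟨hMΩ hzM, ?_⟩⟩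
    have := hzw (v.equivFin ⟨y, Finset.mem_insert_of_mem hy⟩)
    simpa using this
  obtain ⟨xb, hxM, hxC⟩ := hne
  refine ⟨xb, hxM, fun y hy => ?_⟩
  obtain ⟨_, w, hw, hk⟩ := mem_iInter.mp hxC ⟨y, hy⟩
  exact ⟨w, hw, y - w, hk, by simp⟩
end
end

section
/- Let 𝔉(Ω) be the collection of all set-valued mappings G : ℝⁿ ⇉ ℝᵐ with dom G = Ω, G(Ω) := ⋃_{x∈Ω} G(x) bounded, and G(x) compact for every x ∈ Ω, equipped with the metric d(G₁,G₂) := sup_{x∈Ω} d_H(G₁(x),G₂(x)), where d_H is the Hausdorff distance on nonempty compact subsets of ℝᵐ. Then the mappings G ∈ 𝔉(Ω) whose problem (SP) satisfies (wFDVP) are dense in (𝔉(Ω),d): for every F ∈ 𝔉(Ω) and every ε > 0 there exists F̃ ∈ 𝔉(Ω) whose problem (SP) satisfies (wFDVP) and with d(F,F̃) ≤ ε. -/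
open Set Pointwise

noncomputable section

theorem stmt13 (n m : ℕ)
    (Ω : Set (Fin n → ℝ)) (K : Set (Fin m → ℝ)) (e : Fin m → ℝ)
    (hΩne : Ω.Nonempty) (hΩcl : IsClosed Ω)
    (hKcl : IsClosed K) (hKconv : Convex ℝ K)
    (hKcone : ∀ t : ℝ, 0 ≤ t → ∀ y ∈ K, t • y ∈ K)
    (hKpointed : K ∩ (-K) = {0})
    (he : e ∈ interior K)
    (F : (Fin n → ℝ) → Set (Fin m → ℝ))
    (hFdom : ∀ x, (F x).Nonempty ↔ x ∈ Ω)
    (hFbd : Bornology.IsBounded (⋃ x ∈ Ω, F x))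
    (hFcpt : ∀ x ∈ Ω, IsCompact (F x))
    (ε : ℝ) (hε : 0 < ε) :
    ∃ F' : (Fin n → ℝ) → Set (Fin m → ℝ),
      (∀ x, (F' x).Nonempty ↔ x ∈ Ω) ∧
      Bornology.IsBounded (⋃ x ∈ Ω, F' x) ∧
      (∀ x ∈ Ω, IsCompact (F' x)) ∧
      (∃ p : ℕ, 1 ≤ p ∧ VPwX Ω F' K e p 0 = SPwmin Ω F' K e 0) ∧
      ∀ x ∈ Ω, Metric.hausdorffDist (F x) (F' x) ≤ ε := by
  obtain ⟨T, hTfin, hT⟩ := Metric.totallyBounded_iff.1 (hFbd.isCompact_closure.totallyBounded.subset subset_closure) ε hε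
  have hcov : ∀ x ∈ Ω, ∀ y ∈ F x, ∃ t ∈ T, dist y t < ε := by
    intro x hx y hy
    have h := hT (mem_biUnion hx hy)
    simpa using h
  let F' : (Fin n → ℝ) → Set (Fin m → ℝ) := fun x => {t | t ∈ T ∧ ∃ y ∈ F x, dist y t < ε}
  have hF'ne : ∀ x, (F' x).Nonempty ↔ x ∈ Ω := by
    intro x
    constructor
    · rintro ⟨t, _, y, hy, _⟩
      exact (hFdom x).1 ⟨y, hy⟩
    · intro hx
      obtain ⟨y, hy⟩ := (hFdom x).2 hx
      obtain ⟨t, ht, hd⟩ := hcov x hx y hy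
      exact ⟨t, ht, y, hy, hd⟩
  have hF'T : ∀ x, F' x ⊆ T := fun x t ht => ht.1
  refine ⟨F', hF'ne, hTfin.isBounded.subset (iUnion₂_subset fun x _ => hF'T x),
    fun x _ => (hTfin.subset (hF'T x)).isCompact, ?_, ?_⟩
  · obtain ⟨p, f, hf⟩ : ∃ (p : ℕ) (f : Fin p → (Fin m → ℝ)), range f = T := by
      obtain ⟨p, f, _, hf⟩ := hTfin.fin_param
      exact ⟨p, f, hf⟩
    refine ⟨p, ?_, ?_⟩
    · obtain ⟨x, hx⟩ := hΩne
      obtain ⟨t, ht⟩ := (hF'ne x).2 hx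
      have h := hF'T x ht
      rw [← hf] at h
      obtain ⟨i, _⟩ := h
      have := i.2
      omega
    · ext xb
      constructor
      · rintro ⟨yb, ⟨hxb, hyb⟩, hno⟩
        refine ⟨hxb, ?_⟩
        rintro ⟨x, hx, hsub⟩
        have h1 : ∀ i, ∃ y ∈ F' x, (yb i - (0 : ℝ) • e) - y ∈ interior K := by
          intro i
          obtain ⟨a, ha, b, hb, hab⟩ := hsub ⟨yb i, hyb i, rfl⟩
          refine ⟨a, ha, ?_⟩
          have h2 : a + b = yb i - (0 : ℝ) • e := hab
          rw [← h2, add_sub_cancel_left]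
          exact hb
        choose y hy hyK using h1
        exact hno ⟨x, y, ⟨hx, hy⟩, hyK⟩
      · rintro ⟨hxb, hno⟩
        obtain ⟨t0, ht0⟩ := (hF'ne xb).2 hxb
        classical
        refine ⟨fun i => if f i ∈ F' xb then f i else t0, ⟨hxb, ?_⟩, ?_⟩
        · intro i
          by_cases h : f i ∈ F' xb
          · simpa only [if_pos h] using h
          · simpa only [if_neg h] using ht0
        · rintro ⟨x, y, ⟨hx, hy⟩, hK⟩
          apply hno
          refine ⟨x, hx, ?_⟩
          rintro _ ⟨t, ht, rfl⟩
          have h := hF'T xb ht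
          rw [← hf] at h
          obtain ⟨i, rfl⟩ := h
          have h2 := hK i
          simp only [if_pos ht] at h2
          exact ⟨y i, hy i, _, h2, add_sub_cancel _ _⟩
  · intro x hx
    apply Metric.hausdorffDist_le_of_mem_dist hε.le
    · intro y hy
      obtain ⟨t, ht, hd⟩ := hcov x hx y hy
      exact ⟨t, ⟨ht, y, hy, hd⟩, hd.le⟩
    · rintro t ⟨_, y, hy, hd⟩
      exact ⟨y, hy, by rw [dist_comm]; exact hd.le⟩
end
end

section
/- Suppose that Ω is finite (|Ω| < ∞). Then (SP) satisfies (wFDVP): there exists p ∈ ℕ (p ≥ 1) such that wargmin_x(VP_p) = wargmin(SP). -/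
open Set Pointwise

noncomputable section

theorem stmt14 (n m : ℕ)
    (Ω : Set (Fin n → ℝ)) (F : (Fin n → ℝ) → Set (Fin m → ℝ))
    (K : Set (Fin m → ℝ)) (e : Fin m → ℝ)
    (hΩne : Ω.Nonempty) (hΩcl : IsClosed Ω)
    (hdom : ∀ x ∈ Ω, (F x).Nonempty) (hFcpt : ∀ x ∈ Ω, IsCompact (F x))
    (hKcl : IsClosed K) (hKconv : Convex ℝ K)
    (hKcone : ∀ t : ℝ, 0 ≤ t → ∀ y ∈ K, t • y ∈ K)
    (hKpointed : K ∩ (-K) = {0})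
    (he : e ∈ interior K)
    (hΩfin : Ω.Finite) :
    ∃ p : ℕ, 1 ≤ p ∧ VPwX Ω F K e p 0 = SPwmin Ω F K e 0 := by
  classical
  haveI : Fintype Ω := hΩfin.fintype
  haveI : Nonempty Ω := hΩne.to_subtype
  refine ⟨Fintype.card Ω, Fintype.card_pos, ?_⟩
  ext xb
  constructor
  · rintro ⟨yb, ⟨hx, hy⟩, hno⟩
    refine ⟨hx, ?_⟩
    rintro ⟨x, hxΩ, hsub⟩
    apply hno
    have h : ∀ i, ∃ z ∈ F x, (yb i - (0 : ℝ) • e) - z ∈ interior K := by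
      intro i
      obtain ⟨z, hz, k, hk, hzk⟩ := Set.mem_add.mp (hsub ⟨yb i, hy i, rfl⟩)
      refine ⟨z, hz, ?_⟩
      have h2 : (yb i - (0 : ℝ) • e) - z = k := by
        rw [sub_eq_iff_eq_add, add_comm k z]
        exact hzk.symm
      rw [h2]
      exact hk
    choose y hy1 hy2 using h
    exact ⟨x, y, ⟨hxΩ, hy1⟩, hy2⟩
  · rintro ⟨hx, hno⟩
    have h : ∀ x : Ω, ∃ y ∈ F xb, y - (0 : ℝ) • e ∉ F x + interior K := by
      intro x
      by_contra hcon
      push Not at hcon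
      apply hno
      refine ⟨x, x.2, ?_⟩
      rintro _ ⟨y, hy, rfl⟩
      exact hcon y hy
    choose g hg1 hg2 using h
    let φ := (Fintype.equivFin Ω).symm
    refine ⟨fun i => g (φ i), ⟨hx, fun i => hg1 _⟩, ?_⟩
    rintro ⟨x, y, ⟨hxΩ, hy⟩, hall⟩
    have hi := hall (φ.symm ⟨x, hxΩ⟩)
    have hyi := hy (φ.symm ⟨x, hxΩ⟩)
    simp only [Equiv.apply_symm_apply] at hi
    exact hg2 ⟨x, hxΩ⟩ (Set.mem_add.mpr ⟨_, hyi, _, hi, add_sub_cancel _ _⟩)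
end
end

section
/- Suppose that max_{x∈Ω} |Min(F(x),K)| < ∞, i.e. every set of minimal elements Min(F(x),K), x ∈ Ω, is finite and their cardinalities are uniformly bounded. Then (SP) satisfies (wFDVP); in fact wargmin_x(VP_p) = wargmin(SP) holds with p := max_{x∈Ω} |Min(F(x),K)|. -/
open Set Pointwise

noncomputable section

theorem aux_add {m : ℕ} {K : Set (Fin m → ℝ)} (hKconv : Convex ℝ K)
    (hKcone : ∀ t : ℝ, 0 ≤ t → ∀ y ∈ K, t • y ∈ K) {a b : Fin m → ℝ}
    (ha : a ∈ K) (hb : b ∈ K) : a + b ∈ K := by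
  have h := hKconv ha hb (a := 1/2) (b := 1/2) (by norm_num) (by norm_num) (by norm_num)
  have h2 := hKcone 2 (by norm_num) _ h
  have : (2:ℝ) • ((1/2 : ℝ) • a + (1/2 : ℝ) • b) = a + b := by
    rw [smul_add, smul_smul, smul_smul]; norm_num
  rwa [this] at h2

theorem aux_int {m : ℕ} {K : Set (Fin m → ℝ)} (hKconv : Convex ℝ K)
    (hKcone : ∀ t : ℝ, 0 ≤ t → ∀ y ∈ K, t • y ∈ K) {a b : Fin m → ℝ}
    (ha : a ∈ K) (hb : b ∈ interior K) : a + b ∈ interior K := by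
  have ho : IsOpen ((fun z => a + z) '' interior K) :=
    (Homeomorph.addLeft a).isOpenMap _ isOpen_interior
  refine interior_maximal ?_ ho ⟨b, hb, rfl⟩
  rintro _ ⟨z, hz, rfl⟩
  exact aux_add hKconv hKcone ha (interior_subset hz)

theorem aux_dom {m : ℕ} {K A : Set (Fin m → ℝ)} (hKcl : IsClosed K) (hKconv : Convex ℝ K)
    (hKcone : ∀ t : ℝ, 0 ≤ t → ∀ y ∈ K, t • y ∈ K)
    (hKpointed : K ∩ (-K) = {0}) (hA : IsCompact A) {y : Fin m → ℝ} (hy : y ∈ A) :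
    ∃ z ∈ MinSet A K, y - z ∈ K := by
  have h0 : (0 : Fin m → ℝ) ∈ K := by
    have : (0 : Fin m → ℝ) ∈ K ∩ (-K) := by rw [hKpointed]; rfl
    exact this.1
  have htr : ∀ {a b c : Fin m → ℝ}, a - b ∈ K → b - c ∈ K → a - c ∈ K := by
    intro a b c h1 h2
    have := aux_add hKconv hKcone h1 h2
    simpa using this
  let T := {z : Fin m → ℝ // z ∈ A ∧ y - z ∈ K}
  obtain ⟨z, hz⟩ := exists_maximal_of_chains_bounded (α := T)
    (r := fun a b => a.1 - b.1 ∈ K) (by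
      intro c hc
      rcases c.eq_empty_or_nonempty with rfl | hne
      · exact ⟨⟨y, hy, by simpa using h0⟩, by simp⟩
      · haveI : Nonempty c := hne.to_subtype
        have hcl : ∀ w : Fin m → ℝ, IsClosed {u : Fin m → ℝ | w - u ∈ K} := fun w =>
          hKcl.preimage (continuous_const.sub continuous_id)
        obtain ⟨u, hu⟩ := IsCompact.nonempty_iInter_of_directed_nonempty_isCompact_isClosed
          (fun i : c => A ∩ {u | i.1.1 - u ∈ K}) (by
            intro i j
            by_cases hij : i.1 = j.1
            · obtain rfl : i = j := Subtype.ext hij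
              exact ⟨i, subset_rfl, subset_rfl⟩
            rcases hc i.2 j.2 hij with h | h
            · exact ⟨j, fun u hu => ⟨hu.1, htr h hu.2⟩, subset_rfl⟩
            · exact ⟨i, subset_rfl, fun u hu => ⟨hu.1, htr h hu.2⟩⟩)
          (fun i => ⟨i.1.1, i.1.2.1, by simpa using h0⟩)
          (fun i => hA.inter_right (hcl _))
          (fun i => hA.isClosed.inter (hcl _))
        rw [mem_iInter] at hu
        obtain ⟨i, hi⟩ := hne
        refine ⟨⟨u, (hu ⟨i, hi⟩).1, htr i.2.2 (hu ⟨i, hi⟩).2⟩, fun a ha => (hu ⟨a, ha⟩).2⟩)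
    (fun h1 h2 => htr h1 h2)
  refine ⟨z.1, ⟨z.2.1, ?_⟩, z.2.2⟩
  ext w
  constructor
  · rintro ⟨hw, hwA⟩
    rw [singleton_sub] at hw
    obtain ⟨k, hk, rfl⟩ := hw
    have h1 : z.1 - (z.1 - k) ∈ K := by simpa using hk
    have h2 := hz ⟨z.1 - k, hwA, htr z.2.2 h1⟩ h1
    have h3 : k ∈ K ∩ (-K) := ⟨hk, by simpa using h2⟩
    rw [hKpointed] at h3
    simp [mem_singleton_iff.1 h3]
  · rintro rfl
    refine ⟨?_, z.2.1⟩
    rw [singleton_sub]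
    exact ⟨0, h0, by simp⟩

theorem stmt15 (n m : ℕ)
    (Ω : Set (Fin n → ℝ)) (F : (Fin n → ℝ) → Set (Fin m → ℝ))
    (K : Set (Fin m → ℝ)) (e : Fin m → ℝ)
    (hΩne : Ω.Nonempty) (hΩcl : IsClosed Ω)
    (hdom : ∀ x ∈ Ω, (F x).Nonempty) (hFcpt : ∀ x ∈ Ω, IsCompact (F x))
    (hKcl : IsClosed K) (hKconv : Convex ℝ K)
    (hKcone : ∀ t : ℝ, 0 ≤ t → ∀ y ∈ K, t • y ∈ K)
    (hKpointed : K ∩ (-K) = {0})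
    (he : e ∈ interior K)
    (p : ℕ)
    (hfin : ∀ x ∈ Ω, (MinSet (F x) K).Finite)
    (hle : ∀ x ∈ Ω, (MinSet (F x) K).ncard ≤ p)
    (hmax : ∃ x ∈ Ω, (MinSet (F x) K).ncard = p) :
    VPwX Ω F K e p 0 = SPwmin Ω F K e 0 := by
  ext xb
  constructor
  · rintro ⟨yb, ⟨hxb, hyb⟩, hno⟩
    refine ⟨hxb, ?_⟩
    rintro ⟨x, hx, hsub⟩
    apply hno
    have : ∀ i, ∃ y ∈ F x, (yb i - (0:ℝ) • e) - y ∈ interior K := by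
      intro i
      obtain ⟨y, hy, k, hk, h⟩ := hsub ⟨yb i, hyb i, rfl⟩
      refine ⟨y, hy, ?_⟩
      have h' : y + k = yb i - (0:ℝ) • e := h
      rw [← h']
      simpa using hk
    choose y hy hk using this
    exact ⟨x, y, ⟨hx, hy⟩, hk⟩
  · rintro ⟨hxb, hno⟩
    obtain ⟨y0, hy0⟩ := hdom xb hxb
    have hdm := fun {y} hy => aux_dom (y := y) hKcl hKconv hKcone hKpointed (hFcpt xb hxb) hy
    obtain ⟨z0, hz0, -⟩ := hdm hy0
    haveI : Finite (MinSet (F xb) K) := hfin xb hxb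
    haveI : Fintype (MinSet (F xb) K) := Fintype.ofFinite _
    haveI : Nonempty (MinSet (F xb) K) := ⟨⟨z0, hz0⟩⟩
    have hcard : Fintype.card (MinSet (F xb) K) ≤ Fintype.card (Fin p) := by
      rw [Fintype.card_fin, ← Nat.card_eq_fintype_card]
      exact hle xb hxb
    obtain ⟨g⟩ := Function.Embedding.nonempty_of_card_le hcard
    have hsurj := Function.invFun_surjective g.injective
    refine ⟨fun i => (Function.invFun g i).1, ⟨hxb, fun i => (Function.invFun g i).2.1⟩, ?_⟩
    rintro ⟨x, y, ⟨hx, hy⟩, hk⟩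
    refine hno ⟨x, hx, ?_⟩
    rintro _ ⟨w, hw, rfl⟩
    obtain ⟨z, hz, hwz⟩ := hdm hw
    obtain ⟨i, hi⟩ := hsurj ⟨z, hz⟩
    have h1 := hk i
    simp only [hi, zero_smul, sub_zero] at h1
    have h2 := aux_int hKconv hKcone hwz h1
    refine ⟨y i, hy i, w - z + (z - y i), h2, ?_⟩
    simp
end
end

section
/- Suppose that for every x ∈ Ω the value F(x) is a polytope, i.e. the convex hull of a finite set, and that max_{x∈Ω} |ext(F(x))| < ∞, where ext(A) denotes the set of extreme points of a convex set A. Then (SP) satisfies (wFDVP); in fact wargmin_x(VP_p) = wargmin(SP) holds with p := max_{x∈Ω} |ext(F(x))|. -/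
open Set Pointwise

noncomputable section

theorem stmt16 (n m : ℕ)
    (Ω : Set (Fin n → ℝ)) (F : (Fin n → ℝ) → Set (Fin m → ℝ))
    (K : Set (Fin m → ℝ)) (e : Fin m → ℝ)
    (hΩne : Ω.Nonempty) (hΩcl : IsClosed Ω)
    (hdom : ∀ x ∈ Ω, (F x).Nonempty) (hFcpt : ∀ x ∈ Ω, IsCompact (F x))
    (hKcl : IsClosed K) (hKconv : Convex ℝ K)
    (hKcone : ∀ t : ℝ, 0 ≤ t → ∀ y ∈ K, t • y ∈ K)
    (hKpointed : K ∩ (-K) = {0})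
    (he : e ∈ interior K)
    (p : ℕ)
    (hpoly : ∀ x ∈ Ω, ∃ S : Set (Fin m → ℝ), S.Finite ∧ F x = convexHull ℝ S)
    (hfin : ∀ x ∈ Ω, (Set.extremePoints ℝ (F x)).Finite)
    (hle : ∀ x ∈ Ω, (Set.extremePoints ℝ (F x)).ncard ≤ p)
    (hmax : ∃ x ∈ Ω, (Set.extremePoints ℝ (F x)).ncard = p) :
    VPwX Ω F K e p 0 = SPwmin Ω F K e 0 := by
  ext xb
  simp only [VPwX, SPwmin, VPwSol, VPfeas, shiftSet, Set.mem_setOf_eq, zero_smul, sub_zero,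
    Set.image_id']
  constructor
  · rintro ⟨yb, ⟨hxb, hyb⟩, hno⟩
    refine ⟨hxb, ?_⟩
    rintro ⟨x, hx, hsub⟩
    have h : ∀ i, ∃ y ∈ F x, yb i - y ∈ interior K := by
      intro i
      obtain ⟨y, hy, k, hk, hyk⟩ := Set.mem_add.1 (hsub (hyb i))
      exact ⟨y, hy, by rw [← hyk]; simpa using hk⟩
    choose y hy hk using h
    exact hno ⟨x, y, ⟨hx, hy⟩, hk⟩
  · rintro ⟨hxb, hno⟩
    have hconv : ∀ x ∈ Ω, Convex ℝ (F x) := by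
      intro x hx
      obtain ⟨S, -, hS⟩ := hpoly x hx
      rw [hS]; exact convex_convexHull ℝ S
    have hEfin := hfin xb hxb
    obtain ⟨z, hz⟩ := (hFcpt xb hxb).extremePoints_nonempty (hdom xb hxb)
    have hhull : F xb = convexHull ℝ (Set.extremePoints ℝ (F xb)) := by
      have h1 := closure_convexHull_extremePoints (hFcpt xb hxb) (hconv xb hxb)
      rw [(hEfin.isClosed_convexHull ℝ).closure_eq] at h1
      exact h1.symm
    have hex : ∃ yb : Fin p → Fin m → ℝ, Set.range yb = Set.extremePoints ℝ (F xb) := by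
      have : Finite (Set.extremePoints ℝ (F xb)) := hEfin
      have : Nonempty (Set.extremePoints ℝ (F xb)) := ⟨⟨z, hz⟩⟩
      have hc : Nat.card (Set.extremePoints ℝ (F xb)) ≤ p := hle xb hxb
      let φ := Finite.equivFin (Set.extremePoints ℝ (F xb))
      let ι : Set.extremePoints ℝ (F xb) → Fin p := fun a => Fin.castLE hc (φ a)
      have hι : Function.Injective ι := (Fin.castLE_injective hc).comp φ.injective
      refine ⟨fun i => (Function.invFun ι i : Set.extremePoints ℝ (F xb)), ?_⟩
      ext w
      constructor
      · rintro ⟨i, rfl⟩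
        exact (Function.invFun ι i).2
      · intro hw
        exact ⟨ι ⟨w, hw⟩, by simp [Function.leftInverse_invFun hι ⟨w, hw⟩]⟩
    obtain ⟨yb, hyb⟩ := hex
    have hmem : ∀ i, yb i ∈ Set.extremePoints ℝ (F xb) := fun i => hyb ▸ Set.mem_range_self i
    refine ⟨yb, ⟨hxb, fun i => extremePoints_subset (hmem i)⟩, ?_⟩
    rintro ⟨x, y, ⟨hx, hy⟩, hk⟩
    refine hno ⟨x, hx, ?_⟩
    rw [hhull]
    refine convexHull_min ?_ ((hconv x hx).add hKconv.interior)
    rw [← hyb]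
    rintro _ ⟨i, rfl⟩
    exact Set.mem_add.2 ⟨y i, hy i, _, hk i, by abel⟩
end
end

section
/- Suppose that the graph gph F := {(x,y) ∈ ℝⁿ×ℝᵐ | y ∈ F(x)} is convex and let (x̄,ȳ) ∈ gph F. Then the set gph F + ({0_{ℝⁿ}} × K) (which is the graph of the epigraphical multifunction 𝓔_F(x) := F(x)+K) is convex, and N((x̄,ȳ), gph F + ({0}×K)) = N((x̄,ȳ), gph F) ∩ (ℝⁿ × (−K*)). Consequently, for every v ∈ K* one has D*𝓔_F(x̄,ȳ)(v) = D*F(x̄,ȳ)(v). -/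
open Set Pointwise

noncomputable section

theorem stmt17 (n m : ℕ)
    (F : (Fin n → ℝ) → Set (Fin m → ℝ)) (K : Set (Fin m → ℝ))
    (hKcl : IsClosed K) (hKconv : Convex ℝ K)
    (hKcone : ∀ t : ℝ, 0 ≤ t → ∀ y ∈ K, t • y ∈ K)
    (hKpointed : K ∩ (-K) = {0})
    (hKsolid : (interior K).Nonempty)
    (hconv : Convex ℝ (gph F))
    (xb : Fin n → ℝ) (yb : Fin m → ℝ) (hxy : (xb, yb) ∈ gph F) :
    Convex ℝ (gph F + (({0} : Set (Fin n → ℝ)) ×ˢ K)) ∧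
    normalConeProd (gph F + (({0} : Set (Fin n → ℝ)) ×ˢ K)) (xb, yb) =
      normalConeProd (gph F) (xb, yb) ∩ {w | w.2 ∈ -dualCone K} ∧
    ∀ v ∈ dualCone K,
      {u | (u, -v) ∈ normalConeProd (gph F + (({0} : Set (Fin n → ℝ)) ×ˢ K)) (xb, yb)} =
        coderiv F xb yb v := by
  have h0 : (0 : Fin m → ℝ) ∈ K := by
    have : (0 : Fin m → ℝ) ∈ K ∩ (-K) := by rw [hKpointed]; rfl
    exact this.1
  have hadd : ∀ {k : ℕ} (a b c : Fin k → ℝ), dot a (b + c) = dot a b + dot a c := by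
    intro k a b c
    simp only [dot, Pi.add_apply, mul_add, Finset.sum_add_distrib]
  have hneg : ∀ {k : ℕ} (a b : Fin k → ℝ), dot (-a) b = - dot a b := by
    intro k a b
    simp only [dot, Pi.neg_apply, neg_mul, Finset.sum_neg_distrib]
  have hz : ∀ {k : ℕ} (a : Fin k → ℝ), dot a 0 = 0 := by
    intro k a
    simp [dot]
  have key : normalConeProd (gph F + (({0} : Set (Fin n → ℝ)) ×ˢ K)) (xb, yb) =
      normalConeProd (gph F) (xb, yb) ∩ {w | w.2 ∈ -dualCone K} := by
    ext w
    constructor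
    · intro hw
      refine ⟨fun q hq => ?_, ?_⟩
      · exact hw q ⟨q, hq, (0, 0), ⟨rfl, h0⟩, by simp⟩
      · change ∀ y ∈ K, 0 ≤ dot (-w.2) y
        intro y hy
        have h := hw ((xb, yb) + (0, y)) ⟨(xb, yb), hxy, (0, y), ⟨rfl, hy⟩, rfl⟩
        simp only [Prod.mk_add_mk, add_zero, sub_self, add_sub_cancel_left, hz, zero_add] at h
        rw [hneg]
        linarith
    · rintro ⟨hw, hK⟩
      rintro _ ⟨q, hq, ⟨a, y⟩, ⟨ha, hy⟩, rfl⟩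
      have ha' : a = 0 := ha
      subst ha'
      have h1 := hw q hq
      have h2 : 0 ≤ dot (-w.2) y := hK y hy
      rw [hneg] at h2
      have e : q.2 + y - yb = (q.2 - yb) + y := by abel
      simp only [Prod.fst_add, Prod.snd_add, add_zero, e, hadd] at h1 ⊢
      linarith
  refine ⟨hconv.add ((convex_singleton 0).prod hKconv), key, ?_⟩
  intro v hv
  ext u
  simp only [key, coderiv, mem_setOf_eq, mem_inter_iff, Set.mem_neg, neg_neg, hv, and_true]
end
end

section
/- Suppose that Ω ⊆ int dom F and that the graph gph F := {(x,y) ∈ ℝⁿ×ℝᵐ | y ∈ F(x)} is convex. Let x̄ ∈ Ω and set B := {v ∈ K* | vᵀe = 1}. Then the set A := ⋃_{ȳ ∈ Min(F(x̄),K)} D*F(x̄,ȳ)(B) = ⋃_{ȳ ∈ Min(F(x̄),K)} ⋃_{v ∈ B} D*F(x̄,ȳ)(v) is a compact subset of ℝⁿ. -/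
open Set Pointwise

noncomputable section

theorem aux_int_s18 {k : ℕ} (S : Set (Fin k → ℝ)) (x : Fin k → ℝ) (hx : x ∈ interior S) :
    ∃ δ : ℝ, 0 < δ ∧ ∀ i, x + δ • Pi.single i 1 ∈ S ∧ x - δ • Pi.single i 1 ∈ S := by
  rw [mem_interior_iff_mem_nhds, Metric.mem_nhds_iff] at hx
  obtain ⟨r, hr, hb⟩ := hx
  have hn : ∀ i : Fin k, ‖(r / 2) • (Pi.single i 1 : Fin k → ℝ)‖ < r := by
    intro i
    rw [norm_smul, Pi.norm_single, norm_one, mul_one, Real.norm_eq_abs, abs_of_pos (by positivity)]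
    linarith
  refine ⟨r / 2, by positivity, fun i => ⟨hb ?_, hb ?_⟩⟩
  · simpa [mem_ball_iff_norm] using hn i
  · rw [mem_ball_iff_norm, sub_sub_cancel_left, norm_neg]
    exact hn i

theorem dot_add' {k : ℕ} (a b c : Fin k → ℝ) : dot a (b + c) = dot a b + dot a c :=
  dotProduct_add a b c

theorem dot_sub' {k : ℕ} (a b c : Fin k → ℝ) : dot a (b - c) = dot a b - dot a c :=
  dotProduct_sub a b c

theorem dot_neg_left' {k : ℕ} (a b : Fin k → ℝ) : dot (-a) b = - dot a b :=
  neg_dotProduct a b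

theorem dot_smul_single {k : ℕ} (a : Fin k → ℝ) (δ : ℝ) (i : Fin k) :
    dot a (δ • Pi.single i 1) = δ * a i := by
  change a ⬝ᵥ (δ • Pi.single i 1) = _
  rw [dotProduct_smul, dotProduct_single_one, smul_eq_mul]

theorem cont_dot {X : Type*} [TopologicalSpace X] {k : ℕ} {f g : X → Fin k → ℝ}
    (hf : Continuous f) (hg : Continuous g) : Continuous fun x => dot (f x) (g x) := by
  unfold dot
  fun_prop

theorem aux_B {m : ℕ} (K : Set (Fin m → ℝ)) (e : Fin m → ℝ) (he : e ∈ interior K) :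
    IsCompact {v : Fin m → ℝ | v ∈ dualCone K ∧ dot v e = 1} := by
  obtain ⟨δ, hδ, h⟩ := aux_int_s18 K e he
  have hcl : IsClosed {v : Fin m → ℝ | v ∈ dualCone K ∧ dot v e = 1} := by
    refine IsClosed.inter ?_ (isClosed_eq (cont_dot continuous_id continuous_const)
      continuous_const)
    have : dualCone K = ⋂ y ∈ K, {v | 0 ≤ dot v y} := by
      ext v; simp [dualCone]
    change IsClosed (dualCone K)
    rw [this]
    exact isClosed_biInter fun y _ =>
      isClosed_le continuous_const (cont_dot continuous_id continuous_const)
  refine (isCompact_univ_pi (fun _ : Fin m => isCompact_Icc (a := -(1/δ)) (b := 1/δ))).of_isClosed_subset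
    hcl ?_
  rintro v ⟨hv, hv1⟩ i -
  have h1 := hv _ (h i).1
  have h2 := hv _ (h i).2
  rw [dot_add', hv1, dot_smul_single] at h1
  rw [dot_sub', hv1, dot_smul_single] at h2
  constructor
  · rw [neg_le, le_div_iff₀ hδ]; linarith
  · rw [le_div_iff₀ hδ]; linarith

theorem aux_min {m : ℕ} (A K : Set (Fin m → ℝ)) (hA : IsCompact A)
    (hKcl : IsClosed K) (hKconv : Convex ℝ K)
    (hKcone : ∀ t : ℝ, 0 ≤ t → ∀ y ∈ K, t • y ∈ K)
    (hKpointed : K ∩ (-K) = {0}) (y : Fin m → ℝ) (hy : y ∈ A) :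
    ∃ z ∈ MinSet A K, y - z ∈ K := by
  have h0 : (0 : Fin m → ℝ) ∈ K := by
    have : (0 : Fin m → ℝ) ∈ K ∩ (-K) := by rw [hKpointed]; rfl
    exact this.1
  have hadd : ∀ a ∈ K, ∀ b ∈ K, a + b ∈ K := by
    intro a ha b hb
    have := hKcone 2 (by norm_num) _ (hKconv ha hb (a := 1/2) (b := 1/2) (by norm_num)
      (by norm_num) (by norm_num))
    convert this using 1
    module
  have htr : ∀ a b c : Fin m → ℝ, a - b ∈ K → b - c ∈ K → a - c ∈ K := by
    intro a b c h1 h2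
    have := hadd _ h1 _ h2
    simpa using this
  have hclT : ∀ a : Fin m → ℝ, IsClosed {b : Fin m → ℝ | a - b ∈ K} := fun a =>
    hKcl.preimage (continuous_const.sub continuous_id)
  set S : Set (Fin m → ℝ) := A ∩ {b | y - b ∈ K} with hS
  have hyS : y ∈ S := ⟨hy, by simpa using h0⟩
  have hScpt : IsCompact S := hA.inter_right (hclT y)
  obtain ⟨z, hz⟩ := exists_maximal_of_chains_bounded
    (r := fun a b : S => (a : Fin m → ℝ) - b ∈ K) (by
      intro c hc
      rcases c.eq_empty_or_nonempty with rfl | hne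
      · exact ⟨⟨y, hyS⟩, by simp⟩
      have : Nonempty c := hne.to_subtype
      have hk : ∀ a : c, IsCompact (S ∩ {b : Fin m → ℝ | (a : S).1 - b ∈ K}) :=
        fun a => hScpt.inter_right (hclT _)
      obtain ⟨w, hw⟩ := IsCompact.nonempty_iInter_of_directed_nonempty_isCompact_isClosed
        (fun a : c => S ∩ {b : Fin m → ℝ | (a : S).1 - b ∈ K})
        (by
          intro a b
          by_cases hab : a = b
          · subst hab
            exact ⟨a, subset_rfl, subset_rfl⟩
          rcases hc a.2 b.2 (fun h => hab (Subtype.ext h)) with h | h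
          · exact ⟨b, fun x hx => ⟨hx.1, htr _ _ _ h hx.2⟩, subset_rfl⟩
          · exact ⟨a, subset_rfl, fun x hx => ⟨hx.1, htr _ _ _ h hx.2⟩⟩)
        (fun a => ⟨a.1.1, a.1.2, by simpa using h0⟩) hk (fun a => (hk a).isClosed)
      rw [mem_iInter] at hw
      exact ⟨⟨w, (hw (Classical.arbitrary c)).1⟩, fun a ha => (hw ⟨a, ha⟩).2⟩)
    (fun {a b c} h1 h2 => htr _ _ _ h1 h2)
  refine ⟨z, ⟨z.2.1, ?_⟩, z.2.2⟩
  ext w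
  constructor
  · rintro ⟨hw1, hwA⟩
    rw [singleton_sub] at hw1
    obtain ⟨k, hk, rfl⟩ := hw1
    have hzk : (z : Fin m → ℝ) - (z - k) ∈ K := by simpa using hk
    have hmem : (z : Fin m → ℝ) - k ∈ S := ⟨hwA, htr _ _ _ z.2.2 hzk⟩
    have h2 := hz ⟨_, hmem⟩ hzk
    have h3 : k ∈ K ∩ (-K) := ⟨hk, by simpa using h2⟩
    rw [hKpointed] at h3
    have : k = 0 := h3
    simp [this]
  · rintro rfl
    refine ⟨?_, z.2.1⟩
    rw [singleton_sub]
    exact ⟨0, h0, by simp⟩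

theorem mem_coderiv {n m : ℕ} (F : (Fin n → ℝ) → Set (Fin m → ℝ))
    (xb : Fin n → ℝ) (yb v : Fin m → ℝ) (u : Fin n → ℝ) :
    u ∈ coderiv F xb yb v ↔ ∀ q ∈ gph F, dot u (q.1 - xb) ≤ dot v (q.2 - yb) := by
  change (∀ q ∈ gph F, dot u (q.1 - xb) + dot (-v) (q.2 - yb) ≤ 0) ↔ _
  simp only [dot_neg_left']
  refine forall₂_congr fun q _ => ?_
  constructor <;> intro h <;> linarith

theorem stmt18 (n m : ℕ)
    (Ω : Set (Fin n → ℝ)) (F : (Fin n → ℝ) → Set (Fin m → ℝ))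
    (K : Set (Fin m → ℝ)) (e : Fin m → ℝ)
    (hΩne : Ω.Nonempty) (hΩcl : IsClosed Ω)
    (hdom : ∀ x ∈ Ω, (F x).Nonempty) (hFcpt : ∀ x ∈ Ω, IsCompact (F x))
    (hKcl : IsClosed K) (hKconv : Convex ℝ K)
    (hKcone : ∀ t : ℝ, 0 ≤ t → ∀ y ∈ K, t • y ∈ K)
    (hKpointed : K ∩ (-K) = {0})
    (he : e ∈ interior K)
    (hΩint : Ω ⊆ interior {x | (F x).Nonempty})
    (hconv : Convex ℝ (gph F))
    (xb : Fin n → ℝ) (hxb : xb ∈ Ω) :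
    IsCompact (⋃ yb ∈ MinSet (F xb) K,
      ⋃ v ∈ {v : Fin m → ℝ | v ∈ dualCone K ∧ dot v e = 1}, coderiv F xb yb v) := by
  set B := {v : Fin m → ℝ | v ∈ dualCone K ∧ dot v e = 1} with hB
  have hBc : IsCompact B := aux_B K e he
  have hFc : IsCompact (F xb) := hFcpt xb hxb
  -- uniform bound for a fixed graph point
  have hbd : ∀ q ∈ gph F, ∃ C : ℝ, ∀ y ∈ F xb, ∀ v ∈ B, ∀ u ∈ coderiv F xb y v,
      dot u (q.1 - xb) ≤ C := by
    intro q hq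
    have hc : Continuous fun p : (Fin m → ℝ) × (Fin m → ℝ) => dot p.2 (q.2 - p.1) :=
      cont_dot continuous_snd (continuous_const.sub continuous_fst)
    obtain ⟨C, hC⟩ := (hFc.prod hBc).bddAbove_image hc.continuousOn
    refine ⟨C, fun y hy v hv u hu => ?_⟩
    exact ((mem_coderiv _ _ _ _ _).1 hu q hq).trans (hC ⟨(y, v), ⟨hy, hv⟩, rfl⟩)
  obtain ⟨δ, hδ, hd⟩ := aux_int_s18 _ xb (hΩint hxb)
  have hbd2 : ∀ i : Fin n, ∃ C : ℝ, ∀ y ∈ F xb, ∀ v ∈ B, ∀ u ∈ coderiv F xb y v,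
      u i ∈ Icc (-C) C := by
    intro i
    obtain ⟨⟨y1, hy1⟩, ⟨y2, hy2⟩⟩ := hd i
    obtain ⟨C1, h1⟩ := hbd (_, y1) hy1
    obtain ⟨C2, h2⟩ := hbd (_, y2) hy2
    refine ⟨max C1 C2 / δ, fun y hy v hv u hu => ?_⟩
    have a1 := h1 y hy v hv u hu
    have a2 := h2 y hy v hv u hu
    simp only [dot_sub', dot_add', dot_smul_single] at a1 a2
    have m1 := le_max_left C1 C2
    have m2 := le_max_right C1 C2
    constructor
    · rw [neg_le, le_div_iff₀ hδ]; linarith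
    · rw [le_div_iff₀ hδ]; linarith
  choose C hC using hbd2
  let T : Set ((Fin m → ℝ) × (Fin m → ℝ) × (Fin n → ℝ)) :=
    {p | ∀ q ∈ gph F, dot p.2.2 (q.1 - xb) ≤ dot p.2.1 (q.2 - p.1)}
  have hT : IsClosed T := by
    have : T = ⋂ q ∈ gph F, {p | dot p.2.2 (q.1 - xb) ≤ dot p.2.1 (q.2 - p.1)} := by
      ext p; simp [T]
    rw [this]
    exact isClosed_biInter fun q _ => isClosed_le
      (cont_dot (by fun_prop) (by fun_prop)) (cont_dot (by fun_prop) (by fun_prop))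
  have hcpt := ((hFc.prod (hBc.prod (isCompact_univ_pi
    (fun i : Fin n => isCompact_Icc (a := -(C i)) (b := C i))))).inter_right hT).image
    (continuous_snd.comp continuous_snd)
  convert hcpt using 1
  ext u
  simp only [mem_iUnion, exists_prop, mem_image]
  constructor
  · rintro ⟨y, hy, v, hv, hu⟩
    exact ⟨(y, v, u), ⟨⟨hy.1, hv, fun i _ => hC i y hy.1 v hv u hu⟩,
      (mem_coderiv _ _ _ _ _).1 hu⟩, rfl⟩
  · rintro ⟨⟨y, v, u'⟩, ⟨⟨hy, hv, -⟩, hu⟩, rfl⟩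
    obtain ⟨z, hz, hyz⟩ := aux_min (F xb) K hFc hKcl hKconv hKcone hKpointed y hy
    refine ⟨z, hz, v, hv, (mem_coderiv _ _ _ _ _).2 fun q hq => ?_⟩
    have h1 : dot u' (q.1 - xb) ≤ dot v (q.2 - y) := hu q hq
    have h2 : 0 ≤ dot v (y - z) := hv.1 _ hyz
    rw [dot_sub' v] at h1 h2
    change dot u' (q.1 - xb) ≤ _
    rw [dot_sub' v]
    linarith
end
end
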